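/- arXiv:1403.1151 — 8 statements merged into one kernel-verified Lean document; each statement's English description precedes it below -/
import Mathlib

section
/- Let f : ℝ → ℝ satisfy the double-well conditions. Then there exists a function w ∈ C²(ℝ) such that −w''(z) + f(w(z)) = 0 for all z ∈ ℝ, w(0) = 0, lim_{z→+∞} w(z) = 1, and lim_{z→−∞} w(z) = −1. -/
open Filter

/-- `f` satisfies the double-well conditions: it is smooth, `f(±1) = 0`,
`f'(±1) > 0`, and `∫_{-1}^u f = ∫_1^u f > 0` for all `u ∈ (-1,1)`. -/
def DoubleWell (f : ℝ → ℝ) : Prop :=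
  ContDiff ℝ (⊤ : ℕ∞) f ∧ f 1 = 0 ∧ f (-1) = 0 ∧ 0 < deriv f 1 ∧ 0 < deriv f (-1) ∧
  ∀ u ∈ Set.Ioo (-1 : ℝ) 1,
    (∫ s in (-1 : ℝ)..u, f s) = (∫ s in (1 : ℝ)..u, f s) ∧ 0 < ∫ s in (-1 : ℝ)..u, f s

/-- `w` solves the standing-wave problem for `f`: `w ∈ C²(ℝ)`,
`-w'' + f(w) = 0` on `ℝ`, `w(0) = 0`, and `w(z) → ±1` as `z → ±∞`. -/
def StandingWave (f w : ℝ → ℝ) : Prop :=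
  ContDiff ℝ 2 w ∧ (∀ z : ℝ, -(deriv (deriv w) z) + f (w z) = 0) ∧ w 0 = 0 ∧
  Tendsto w atTop (nhds 1) ∧ Tendsto w atBot (nhds (-1))

theorem potential_bound (f : ℝ → ℝ) (hf : ContDiff ℝ 1 f) (h1 : f 1 = 0) (h2 : f (-1) = 0)
    (W : ℝ → ℝ) (hW : ∀ u, HasDerivAt W (f u) u) (hW1 : W 1 = 0) (hW2 : W (-1) = 0) :
    ∃ K : ℝ, 0 < K ∧ ∀ u ∈ Set.Ioo (-1 : ℝ) 1, W u ≤ K * (1 - u ^ 2) ^ 2 := by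
  have hd : Continuous (deriv f) := hf.continuous_deriv le_rfl
  obtain ⟨L, hL⟩ := (isCompact_Icc (a := (-1 : ℝ)) (b := 1)).exists_bound_of_continuousOn
    hd.continuousOn
  have hL0 : 0 ≤ L := (norm_nonneg _).trans (hL 0 (by norm_num))
  have key : ∀ a ∈ Set.Icc (-1 : ℝ) 1, f a = 0 → W a = 0 → ∀ u ∈ Set.Icc (-1 : ℝ) 1,
      W u ≤ L * (u - a) ^ 2 := by
    intro a ha hfa hWa u hu
    have hfb : ∀ x ∈ Set.Icc (-1 : ℝ) 1, |f x| ≤ L * |x - a| := by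
      intro x hx
      have := (convex_Icc (-1 : ℝ) 1).norm_image_sub_le_of_norm_deriv_le
        (fun y _ => (hf.differentiable one_ne_zero) y) hL ha hx
      simpa [hfa] using this
    have hsub : Set.uIcc a u ⊆ Set.Icc (-1 : ℝ) 1 := (Set.ordConnected_Icc).uIcc_subset ha hu
    have := (convex_uIcc a u).norm_image_sub_le_of_norm_hasDerivWithin_le
      (f := W) (f' := f) (C := L * |u - a|) (fun x _ => (hW x).hasDerivWithinAt)
      (fun x hx => (hfb x (hsub hx)).trans
        (mul_le_mul_of_nonneg_left (Set.abs_sub_left_of_mem_uIcc hx) hL0))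
      Set.left_mem_uIcc Set.right_mem_uIcc
    rw [hWa, sub_zero, Real.norm_eq_abs, Real.norm_eq_abs, mul_assoc, abs_mul_abs_self] at this
    calc W u ≤ |W u| := le_abs_self _
      _ ≤ _ := this
      _ = _ := by ring
  refine ⟨L + 1, by linarith, fun u hu => ?_⟩
  have hu' : u ∈ Set.Icc (-1 : ℝ) 1 := ⟨hu.1.le, hu.2.le⟩
  have hsq : ∀ x : ℝ, 0 ≤ x → x ≤ 1 - u ^ 2 → L * x ^ 2 ≤ (L + 1) * (1 - u ^ 2) ^ 2 := by
    intro x hx hxu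
    have : x ^ 2 ≤ (1 - u ^ 2) ^ 2 := pow_le_pow_left₀ hx hxu 2
    nlinarith [sq_nonneg x]
  rcases le_total 0 u with h | h
  · have := key 1 (by norm_num) h1 hW1 u hu'
    have h3 := hsq (1 - u) (by linarith [hu.2]) (by nlinarith [hu.2])
    nlinarith
  · have := key (-1) (by norm_num) h2 hW2 u hu'
    have h3 := hsq (1 + u) (by linarith [hu.1]) (by nlinarith [hu.1])
    nlinarith

theorem exists_inverse (h : ℝ → ℝ) (hc : Continuous h) (c : ℝ) (hc0 : 0 < c)
    (hh : ∀ t, c ≤ h t) :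
    ∃ v : ℝ → ℝ, v 0 = 0 ∧ Tendsto v atTop atTop ∧ Tendsto v atBot atBot ∧
      ∀ z, HasDerivAt v (h (v z))⁻¹ z := by
  let H : ℝ → ℝ := fun t => ∫ s in (0 : ℝ)..t, h s
  have hH : ∀ t, HasDerivAt H (h t) t := fun t =>
    intervalIntegral.integral_hasDerivAt_right (hc.intervalIntegrable _ _)
      hc.stronglyMeasurable.stronglyMeasurableAtFilter hc.continuousAt
  have hH0 : H 0 = 0 := by simp [H]
  have hmono : StrictMono H := strictMono_of_deriv_pos fun t => by
    rw [(hH t).deriv]; exact hc0.trans_le (hh t)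
  have hm2 : Monotone fun t => H t - c * t := by
    have hd : ∀ t, HasDerivAt (fun t => H t - c * t) (h t - c * 1) t := fun t =>
      (hH t).sub ((hasDerivAt_id t).const_mul c)
    refine monotone_of_deriv_nonneg (fun t => (hd t).differentiableAt) fun t => ?_
    rw [(hd t).deriv]; linarith [hh t]
  have hcont : Continuous H := continuous_iff_continuousAt.2 fun t => (hH t).continuousAt
  have htop : Tendsto H atTop atTop := by
    refine tendsto_atTop_mono' _ ?_ (tendsto_id.const_mul_atTop hc0)
    filter_upwards [eventually_ge_atTop 0] with t ht
    have := hm2 ht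
    simp only [hH0, id] at this ⊢
    linarith
  have hbot : Tendsto H atBot atBot := by
    refine tendsto_atBot_mono' _ ?_ (tendsto_id.const_mul_atBot hc0)
    filter_upwards [eventually_le_atBot 0] with t ht
    have := hm2 ht
    simp only [hH0, id] at this ⊢
    linarith
  have hsurj : Function.Surjective H := hcont.surjective htop hbot
  let e : ℝ ≃o ℝ := hmono.orderIsoOfSurjective H hsurj
  have he : ∀ z, H (e.symm z) = z := fun z => e.apply_symm_apply z
  refine ⟨e.symm, ?_, e.symm.tendsto_atTop, e.symm.tendsto_atBot, fun z => ?_⟩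
  · apply hmono.injective; rw [he, hH0]
  · exact HasDerivAt.of_local_left_inverse e.symm.continuous.continuousAt (hH _)
      (hc0.trans_le (hh _)).ne' (Eventually.of_forall he)

/-- Existence of a solution to the standing-wave problem. -/
theorem standingWave_exists (f : ℝ → ℝ) (hf : DoubleWell f) :
    ∃ w : ℝ → ℝ, StandingWave f w := by
  obtain ⟨hs, h1, h2, -, -, hi⟩ := hf
  have hfc : Continuous f := hs.continuous
  let W : ℝ → ℝ := fun u => ∫ s in (-1 : ℝ)..u, f s
  have hW : ∀ t, HasDerivAt W (f t) t := fun t =>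
    intervalIntegral.integral_hasDerivAt_right (hfc.intervalIntegrable _ _)
      hfc.stronglyMeasurable.stronglyMeasurableAtFilter hfc.continuousAt
  have hW2 : W (-1) = 0 := by simp [W]
  have hW1 : W 1 = 0 := by
    have h0 := (hi 0 (by norm_num)).1
    have := intervalIntegral.integral_add_adjacent_intervals (μ := MeasureTheory.volume)
      (hfc.intervalIntegrable (-1) 0) (hfc.intervalIntegrable 0 1)
    rw [intervalIntegral.integral_symm 0 1] at h0
    simp only [W]; linarith
  have hpos : ∀ u ∈ Set.Ioo (-1 : ℝ) 1, 0 < W u := fun u hu => (hi u hu).2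
  obtain ⟨K, hK, hKb⟩ := potential_bound f (hs.of_le (by exact_mod_cast le_top)) h1 h2 W hW hW1 hW2
  have hWc : Continuous W := continuous_iff_continuousAt.2 fun t => (hW t).continuousAt
  let g : ℝ → ℝ := fun u => √(2 * W u)
  have hgc : Continuous g := (continuous_const.mul hWc).sqrt
  have hgpos : ∀ u ∈ Set.Ioo (-1 : ℝ) 1, 0 < g u := fun u hu =>
    Real.sqrt_pos.2 (by linarith [hpos u hu])
  have hgd : ∀ u ∈ Set.Ioo (-1 : ℝ) 1, HasDerivAt g (f u / g u) u := fun u hu => by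
    refine HasDerivAt.congr_deriv (((hW u).const_mul 2).sqrt (by linarith [hpos u hu])) ?_
    simp only [g]
    rw [mul_div_mul_left _ _ two_ne_zero]
  have hgb : ∀ u ∈ Set.Ioo (-1 : ℝ) 1, g u ≤ √(2 * K) * (1 - u ^ 2) := fun u hu => by
    have h0 : 0 ≤ 1 - u ^ 2 := by nlinarith [hu.1, hu.2]
    apply Real.sqrt_le_iff.2 ⟨by positivity, ?_⟩
    rw [mul_pow, Real.sq_sqrt (by positivity)]
    linarith [hKb u hu]
  have hs2 : 0 < √(2 * K) := Real.sqrt_pos.2 (by positivity)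
  let φ : ℝ → ℝ := fun t => 2 * Real.sigmoid t - 1
  have hφm : ∀ t, φ t ∈ Set.Ioo (-1 : ℝ) 1 := fun t => by
    have := Real.sigmoid_pos t
    have := Real.sigmoid_lt_one t
    constructor <;> simp only [φ] <;> linarith
  have hφc : Continuous φ := by
    have := continuous_sigmoid
    fun_prop
  have hφd : ∀ t, HasDerivAt φ ((1 - φ t ^ 2) / 2) t := fun t => by
    refine HasDerivAt.congr_deriv (((Real.hasDerivAt_sigmoid t).const_mul 2).sub_const 1) ?_
    simp only [φ]; ring
  let h : ℝ → ℝ := fun t => ((1 - φ t ^ 2) / 2) / g (φ t)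
  have hhc : Continuous h := by
    refine Continuous.div (by fun_prop) (hgc.comp hφc) fun t => (hgpos _ (hφm t)).ne'
  have hhb : ∀ t, 1 / (2 * √(2 * K)) ≤ h t := fun t => by
    have := hgb _ (hφm t)
    simp only [h]
    rw [div_le_div_iff₀ (by positivity) (hgpos _ (hφm t))]
    linarith
  obtain ⟨v, hv0, hvt, hvb, hvd⟩ := exists_inverse h hhc _ (by positivity) hhb
  let w : ℝ → ℝ := fun z => φ (v z)
  have hwm : ∀ z, w z ∈ Set.Ioo (-1 : ℝ) 1 := fun z => hφm _
  have hwd : ∀ z, HasDerivAt w (g (w z)) z := fun z => by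
    refine HasDerivAt.congr_deriv ((hφd (v z)).comp z (hvd z)) ?_
    have h3 : 0 < 1 - φ (v z) ^ 2 := by nlinarith [(hφm (v z)).1, (hφm (v z)).2]
    simp only [h, w]
    field_simp
  have hwdd : ∀ z, HasDerivAt (fun z => g (w z)) (f (w z)) z := fun z => by
    refine HasDerivAt.congr_deriv ((hgd _ (hwm z)).comp z (hwd z)) ?_
    exact (div_mul_cancel₀ _ (hgpos _ (hwm z)).ne')
  have hwc : Continuous w := continuous_iff_continuousAt.2 fun t => (hwd t).continuousAt
  have hd1 : deriv w = fun z => g (w z) := funext fun z => (hwd z).deriv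
  have hd2 : deriv (deriv w) = fun z => f (w z) := by
    rw [hd1]; exact funext fun z => (hwdd z).deriv
  refine ⟨w, ?_, fun z => by rw [hd2]; simp, ?_, ?_, ?_⟩
  · have : ContDiff ℝ (1 + 1) w := by
      refine contDiff_succ_iff_deriv.2 ⟨fun z => (hwd z).differentiableAt, by simp, ?_⟩
      refine contDiff_one_iff_deriv.2 ⟨?_, by rw [hd2]; exact hfc.comp hwc⟩
      rw [hd1]; exact fun z => (hwdd z).differentiableAt
    simpa [one_add_one_eq_two] using this
  · simp only [w, hv0, φ, Real.sigmoid_zero]; norm_num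
  · have := ((Real.tendsto_sigmoid_atTop.comp hvt).const_mul 2).sub_const 1
    norm_num at this
    exact this
  · have := ((Real.tendsto_sigmoid_atBot.comp hvb).const_mul 2).sub_const 1
    norm_num at this
    exact this
end

section
/- Let f : ℝ → ℝ satisfy the double-well conditions. If w₁ and w₂ are two solutions of the standing-wave problem, then w₁(z) = w₂(z) for all z ∈ ℝ. -/
open Filter

lemma ode_uniq (f : ℝ → ℝ) (hf : ContDiff ℝ 1 f) (u v : ℝ → ℝ)
    (hu : ContDiff ℝ 2 u) (hv : ContDiff ℝ 2 v)
    (hu2 : ∀ z, deriv (deriv u) z = f (u z)) (hv2 : ∀ z, deriv (deriv v) z = f (v z))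
    (t₀ : ℝ) (h0 : u t₀ = v t₀) (h1 : deriv u t₀ = deriv v t₀) : u = v := by
  have key : ∀ w : ℝ → ℝ, ContDiff ℝ 2 w → (∀ z, deriv (deriv w) z = f (w z)) →
      ∀ t, HasDerivAt (fun t => (w t, deriv w t)) ((deriv w t, f (w t)) : ℝ × ℝ) t := by
    intro w hw hw2 t
    have hd : Differentiable ℝ (deriv w) :=
      (hw.iterate_deriv' 1 1).differentiable (by norm_num)
    have a := (hw.differentiable (by norm_num) t).hasDerivAt
    have b := (hd t).hasDerivAt
    rw [hw2] at b
    exact a.prodMk b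
  have ku := key u hu hu2
  have kv := key v hv hv2
  have cu : Continuous (fun t => (u t, deriv u t)) :=
    continuous_iff_continuousAt.2 fun t => (ku t).continuousAt
  have cv : Continuous (fun t => (v t, deriv v t)) :=
    continuous_iff_continuousAt.2 fun t => (kv t).continuousAt
  ext t
  let a := min t t₀ - 1
  let b := max t t₀ + 1
  have hta : t ∈ Set.Ioo a b := by
    constructor <;> simp only [a, b]
    · linarith [min_le_left t t₀]
    · linarith [le_max_left t t₀]
  have ht0 : t₀ ∈ Set.Ioo a b := by
    constructor <;> simp only [a, b]
    · linarith [min_le_right t t₀]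
    · linarith [le_max_right t t₀]
  obtain ⟨M1, hM1⟩ := ((isCompact_Icc (a := a) (b := b)).image cu).isBounded.subset_closedBall 0
  obtain ⟨M2, hM2⟩ := ((isCompact_Icc (a := a) (b := b)).image cv).isBounded.subset_closedBall 0
  let V : ℝ × ℝ → ℝ × ℝ := fun p => (p.2, f p.1)
  have hV : ContDiff ℝ 1 V := contDiff_snd.prodMk (hf.comp contDiff_fst)
  obtain ⟨K, hK⟩ := (hV.contDiffOn (s := Metric.closedBall 0 (max M1 M2))).exists_lipschitzOnWith
    one_ne_zero (convex_closedBall _ _) (isCompact_closedBall _ _)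
  have := ODE_solution_unique_of_mem_Ioo (v := fun _ => V) (fun _ _ => hK) ht0
    (f := fun t => (u t, deriv u t)) (g := fun t => (v t, deriv v t))
    (fun s hs => ⟨ku s, Metric.closedBall_subset_closedBall (le_max_left _ _)
      (hM1 (Set.mem_image_of_mem _ (Set.Ioo_subset_Icc_self hs)))⟩)
    (fun s hs => ⟨kv s, Metric.closedBall_subset_closedBall (le_max_right _ _)
      (hM2 (Set.mem_image_of_mem _ (Set.Ioo_subset_Icc_self hs)))⟩)
    (by simp [h0, h1]) hta
  exact congrArg Prod.fst this

lemma wave_slope (f : ℝ → ℝ) (hf : DoubleWell f) (w : ℝ → ℝ) (hw : StandingWave f w) :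
    0 < deriv w 0 ∧ (deriv w 0) ^ 2 = 2 * ∫ s in (-1 : ℝ)..0, f s := by
  obtain ⟨hfs, hf1, hfm1, -, -, hF⟩ := hf
  obtain ⟨hwc, hode, hw0, htop, hbot⟩ := hw
  have hode' : ∀ z, deriv (deriv w) z = f (w z) := fun z => by linarith [hode z]
  have hfc : Continuous f := hfs.continuous
  have hf1' : ContDiff ℝ 1 f := hfs.of_le (by exact_mod_cast le_top)
  have hd : Differentiable ℝ w := hwc.differentiable (by norm_num)
  have hd' : Differentiable ℝ (deriv w) :=
    (hwc.iterate_deriv' 1 1).differentiable (by norm_num)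
  let F : ℝ → ℝ := fun u => ∫ s in (-1 : ℝ)..u, f s
  have hFd : ∀ u, HasDerivAt F (f u) u := fun u => hfc.integral_hasStrictDerivAt (-1) u |>.hasDerivAt
  have hFc : Continuous F := continuous_iff_continuousAt.2 fun u => (hFd u).continuousAt
  let E : ℝ → ℝ := fun z => (deriv w z) ^ 2 - 2 * F (w z)
  have hEd : ∀ z, HasDerivAt E 0 z := by
    intro z
    have h1 := ((hd' z).hasDerivAt.pow 2)
    have h2 := ((hFd (w z)).comp z (hd z).hasDerivAt).const_mul 2
    have h3 : HasDerivAt E _ z := h1.sub h2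
    refine h3.congr_deriv ?_
    rw [hode']
    push_cast
    ring
  have hEc : ∀ x y, E x = E y :=
    is_const_of_deriv_eq_zero (fun z => (hEd z).differentiableAt) (fun z => (hEd z).deriv)
  have hFm1 : F (-1) = 0 := by simp [F]
  have hF1 : F 1 = 0 := by
    have h := (hF 0 (by norm_num)).1
    have h2 := intervalIntegral.integral_add_adjacent_intervals
      (hfc.intervalIntegrable (μ := MeasureTheory.volume) (-1) 0)
      (hfc.intervalIntegrable (μ := MeasureTheory.volume) 0 1)
    rw [intervalIntegral.integral_symm 0 1] at h
    simp only [F]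
    linarith
  -- the energy vanishes
  have hE0 : E 0 = 0 := by
    have hmv : ∀ x : ℝ, ∃ ξ ∈ Set.Ioo x (x + 1), deriv w ξ = w (x + 1) - w x := by
      intro x
      obtain ⟨ξ, h, h'⟩ := exists_deriv_eq_slope w (lt_add_one x) hd.continuous.continuousOn
        hd.differentiableOn
      exact ⟨ξ, h, by rw [h']; simp⟩
    choose ξ hξ hξ' using hmv
    have t1 : Tendsto ξ atTop atTop := tendsto_atTop_mono (fun x => (hξ x).1.le) tendsto_id
    have t2 : Tendsto (fun x => deriv w (ξ x)) atTop (nhds (1 - 1)) := by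
      simp only [hξ']
      exact (htop.comp (tendsto_atTop_add_const_right _ 1 tendsto_id)).sub htop
    have t3 : Tendsto (fun x => F (w (ξ x))) atTop (nhds (F 1)) :=
      (hFc.tendsto 1).comp (htop.comp t1)
    have t4 := (t2.pow 2).sub (t3.const_mul 2)
    have t5 : Tendsto (fun _ : ℝ => E 0) atTop (nhds ((1 - 1) ^ 2 - 2 * F 1)) :=
      t4.congr (fun x => hEc (ξ x) 0)
    have := tendsto_nhds_unique tendsto_const_nhds t5
    rw [this, hF1]; norm_num
  have hE : ∀ z, (deriv w z) ^ 2 = 2 * F (w z) := fun z => by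
    have := hEc z 0
    rw [hE0] at this
    simp only [E] at this
    linarith
  have hne : ∀ c, f c = 0 → F c = 0 → c ≠ 0 → ∀ z, w z ≠ c := by
    intro c hc hFc0 hc0 z hz
    have h0 : deriv w z = 0 := by
      have := hE z
      rw [hz, hFc0] at this
      simpa using this
    have := ode_uniq f hf1' w (fun _ => c) hwc contDiff_const hode' (by simp [hc]) z hz
      (by simp [h0])
    rw [this] at hw0
    exact hc0 hw0
  have hlt : ∀ z, w z < 1 := by
    intro z
    by_contra! h
    obtain ⟨y, hy⟩ := mem_range_of_exists_le_of_exists_ge hd.continuous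
      ⟨0, by rw [hw0]; exact zero_le_one⟩ ⟨z, h⟩
    exact hne 1 hf1 hF1 one_ne_zero y hy
  have hgt : ∀ z, -1 < w z := by
    intro z
    by_contra! h
    obtain ⟨y, hy⟩ := mem_range_of_exists_le_of_exists_ge hd.continuous
      ⟨z, h⟩ ⟨0, by rw [hw0]; norm_num⟩
    exact hne (-1) hfm1 hFm1 (by norm_num) y hy
  have hd0 : ∀ z, deriv w z ≠ 0 := by
    intro z h
    have h1 := hE z
    have h2 := (hF (w z) ⟨hgt z, hlt z⟩).2
    rw [h] at h1
    simp only [F] at h1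
    linarith
  refine ⟨?_, by have := hE 0; rwa [hw0] at this⟩
  by_contra! h
  have hneg : ∀ z, deriv w z < 0 := by
    intro z
    by_contra! hz
    obtain ⟨y, hy⟩ := mem_range_of_exists_le_of_exists_ge hd'.continuous ⟨0, h⟩ ⟨z, hz⟩
    exact hd0 y hy
  have hanti : Antitone w := (strictAnti_of_deriv_neg hneg).antitone
  have := hanti.le_of_tendsto htop 0
  rw [hw0] at this
  linarith

/-- Uniqueness of the solution to the standing-wave problem. -/
theorem standingWave_unique (f : ℝ → ℝ) (hf : DoubleWell f) (w₁ w₂ : ℝ → ℝ)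
    (h₁ : StandingWave f w₁) (h₂ : StandingWave f w₂) :
    ∀ z : ℝ, w₁ z = w₂ z := by
  obtain ⟨p1, e1⟩ := wave_slope f hf w₁ h₁
  obtain ⟨p2, e2⟩ := wave_slope f hf w₂ h₂
  have hs : deriv w₁ 0 = deriv w₂ 0 :=
    (pow_left_inj₀ p1.le p2.le two_ne_zero).1 (e1.trans e2.symm)
  have hf1' : ContDiff ℝ 1 f := hf.1.of_le (by exact_mod_cast le_top)
  intro z
  exact congrFun (ode_uniq f hf1' w₁ w₂ h₁.1 h₂.1 (fun z => by linarith [h₁.2.1 z])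
    (fun z => by linarith [h₂.2.1 z]) 0 (by rw [h₁.2.2.1, h₂.2.2.1]) hs) z
end

section
/- Let f : ℝ → ℝ satisfy the double-well conditions and let w be a solution of the standing-wave problem. Then w'(z) > 0 for all z ∈ ℝ. -/
open Filter

lemma gron_aux (v : ℝ → ℝ) (hv : Differentiable ℝ v) (M K a : ℝ) (hM : 0 ≤ M)
    (ha : a ∈ Set.Icc (-M) M) (h : ∀ z ∈ Set.Icc (-M) M, |deriv v z| ≤ K * |v z|)
    (hva : v a = 0) : v 0 = 0 := by
  have h0 : (0 : ℝ) ∈ Set.Icc (-M) M := ⟨by linarith, hM⟩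
  have key : ∀ z ∈ Set.Icc (-M) M, |v z * deriv v z| ≤ K * v z ^ 2 := by
    intro z hz
    rw [abs_mul]
    have h1 := mul_le_mul_of_nonneg_left (h z hz) (abs_nonneg (v z))
    rw [← sq_abs (v z)]
    linarith
  have hd : ∀ c z : ℝ, HasDerivAt (fun z => v z ^ 2 * Real.exp (c * z))
      ((2 * (v z * deriv v z) + c * v z ^ 2) * Real.exp (c * z)) z := by
    intro c z
    have h1 := ((hv z).hasDerivAt.pow 2).mul (((hasDerivAt_id z).const_mul c).exp)
    refine h1.congr_deriv ?_
    simp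
    ring
  rcases le_total 0 a with h0a | h0a
  · have : MonotoneOn (fun z => v z ^ 2 * Real.exp ((2 * K) * z)) (Set.Icc (-M) M) := by
      apply monotoneOn_of_deriv_nonneg (convex_Icc _ _)
      · exact fun z _ => (hd _ z).continuousAt.continuousWithinAt
      · exact fun z _ => (hd _ z).differentiableAt.differentiableWithinAt
      · intro z hz
        rw [(hd _ z).deriv]
        have := abs_le.1 (key z (interior_subset hz))
        exact mul_nonneg (by linarith [this.1]) (Real.exp_pos _).le
    have := this h0 ha h0a
    simp [hva] at this
    nlinarith [sq_nonneg (v 0)]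
  · have : AntitoneOn (fun z => v z ^ 2 * Real.exp ((-(2 * K)) * z)) (Set.Icc (-M) M) := by
      apply antitoneOn_of_deriv_nonpos (convex_Icc _ _)
      · exact fun z _ => (hd _ z).continuousAt.continuousWithinAt
      · exact fun z _ => (hd _ z).differentiableAt.differentiableWithinAt
      · intro z hz
        rw [(hd _ z).deriv]
        have := abs_le.1 (key z (interior_subset hz))
        exact mul_nonpos_of_nonpos_of_nonneg (by linarith [this.2]) (Real.exp_pos _).le
    have := this ha h0 h0a
    simp [hva] at this
    nlinarith [sq_nonneg (v 0)]

/-- A solution of `w'^2 = 2 F(w)` never meets a double zero `p` of `F`, unless at `0`. -/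
lemma ne_aux (f F w : ℝ → ℝ) (p : ℝ) (hf : ContDiff ℝ 1 f) (hF : ∀ u, HasDerivAt F (f u) u)
    (hw : Differentiable ℝ w) (hE : ∀ z, deriv w z ^ 2 = 2 * F (w z))
    (hfp : f p = 0) (hFp : F p = 0) (a : ℝ) (ha : w a = p) : w 0 = p := by
  obtain ⟨R, hR⟩ := (isCompact_Icc (a := -|a|) (b := |a|)).exists_bound_of_continuousOn
    hw.continuous.continuousOn
  have haI : a ∈ Set.Icc (-|a|) |a| := ⟨neg_abs_le a, le_abs_self a⟩
  obtain ⟨L, hL⟩ := (isCompact_Icc (a := -R) (b := R)).exists_bound_of_continuousOn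
    (hf.continuous_deriv le_rfl).continuousOn
  have hpI : p ∈ Set.Icc (-R) R := abs_le.1 (ha ▸ hR a haI)
  have hL0 : 0 ≤ L := (norm_nonneg _).trans (hL p hpI)
  have hfb : ∀ u ∈ Set.Icc (-R) R, |f u| ≤ L * |u - p| := by
    intro u hu
    have := Convex.norm_image_sub_le_of_norm_deriv_le (f := f)
      (fun x _ => (hf.differentiable one_ne_zero) x) hL (convex_Icc _ _) hpI hu
    simpa [hfp] using this
  have hFb : ∀ u ∈ Set.Icc (-R) R, |F u| ≤ L * |u - p| * |u - p| := by
    intro u hu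
    have := Convex.norm_image_sub_le_of_norm_deriv_le (f := F) (s := Set.uIcc p u)
      (C := L * |u - p|)
      (fun x _ => (hF x).differentiableAt) (fun x hx => by
        rw [(hF x).deriv]
        refine (hfb x (Set.uIcc_subset_Icc hpI hu hx)).trans ?_
        exact mul_le_mul_of_nonneg_left (Set.abs_sub_left_of_mem_uIcc hx) hL0)
      (convex_uIcc _ _) Set.left_mem_uIcc Set.right_mem_uIcc
    simpa [hFp] using this
  have := gron_aux (fun z => w z - p) (hw.sub_const p) |a| (2 * L + 1) a (abs_nonneg a) haI ?_
    (by simp [ha])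
  · linarith
  · intro z hz
    rw [deriv_sub_const]
    have h1 := hFb (w z) (abs_le.1 (hR z hz))
    have h2 := hE z
    refine abs_le_of_sq_le_sq ?_ (by positivity)
    rw [mul_pow]
    have h3 := le_abs_self (F (w z))
    nlinarith [mul_nonneg hL0 (mul_self_nonneg |w z - p|), mul_self_nonneg |w z - p|,
      mul_nonneg (mul_nonneg hL0 hL0) (mul_self_nonneg |w z - p|)]

/-- Strict monotonicity of the standing wave: `w'(z) > 0` for all `z ∈ ℝ`. -/
theorem standingWave_deriv_pos (f w : ℝ → ℝ) (hf : DoubleWell f)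
    (hw : StandingWave f w) :
    ∀ z : ℝ, 0 < deriv w z := by
  obtain ⟨hfs, hf1, hfm1, -, -, hI⟩ := hf
  obtain ⟨hws, hode, hw0, htop, hbot⟩ := hw
  have hfc : Continuous f := hfs.continuous
  set F : ℝ → ℝ := fun u => ∫ s in (-1 : ℝ)..u, f s with hFdef
  have hF : ∀ u, HasDerivAt F (f u) u := fun u =>
    intervalIntegral.integral_hasDerivAt_right (hfc.intervalIntegrable _ _)
      (hfc.stronglyMeasurableAtFilter _ _) hfc.continuousAt
  have hFm1 : F (-1) = 0 := by simp [hFdef]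
  have hF1 : F 1 = 0 := by
    have h := (hI 0 (by norm_num)).1
    have h2 := intervalIntegral.integral_add_adjacent_intervals
      (hfc.intervalIntegrable (μ := MeasureTheory.volume) (-1) 0) (hfc.intervalIntegrable 0 1)
    rw [intervalIntegral.integral_symm 0 1] at h
    simp only [hFdef]
    linarith
  have hwd : Differentiable ℝ w := hws.differentiable two_ne_zero
  have hdw : ContDiff ℝ 1 (deriv w) := by
    have : ContDiff ℝ (1 + 1) w := by simpa [one_add_one_eq_two] using hws
    exact (contDiff_succ_iff_deriv.1 this).2.2
  have hdwd : Differentiable ℝ (deriv w) := hdw.differentiable one_ne_zero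
  have hEd : ∀ z, HasDerivAt (fun z => deriv w z ^ 2 - 2 * F (w z)) 0 z := by
    intro z
    have h1 := ((hdwd z).hasDerivAt.pow 2).sub
      (((hF (w z)).comp z (hwd z).hasDerivAt).const_mul 2)
    refine h1.congr_deriv ?_
    have := hode z
    have h3 : deriv (deriv w) z = f (w z) := by linarith
    rw [h3]
    simp
    ring
  obtain ⟨c, hc⟩ : ∃ c, ∀ z, deriv w z ^ 2 = 2 * F (w z) + c := by
    refine ⟨deriv w 0 ^ 2 - 2 * F (w 0), fun z => ?_⟩
    have := is_const_of_deriv_eq_zero (fun z => (hEd z).differentiableAt)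
      (fun z => (hEd z).deriv) z 0
    linarith
  have hc0 : c = 0 := by
    have hmvt : ∀ z : ℝ, ∃ x, z < x ∧ deriv w x = w (z + 1) - w z := by
      intro z
      obtain ⟨x, hx, hx2⟩ := exists_deriv_eq_slope w (show z < z + 1 by linarith)
        hwd.continuous.continuousOn hwd.differentiableOn
      exact ⟨x, hx.1, by simpa using hx2⟩
    choose x hx hx2 using hmvt
    have hxt : Tendsto x atTop atTop := tendsto_atTop_mono (fun z => (hx z).le) tendsto_id
    have h1 : Tendsto (fun z => deriv w (x z) ^ 2) atTop (nhds ((1 - 1) ^ 2)) := by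
      simp only [hx2]
      exact ((htop.comp (tendsto_atTop_add_const_right _ 1 tendsto_id)).sub htop).pow 2
    have h2 : Tendsto (fun z => deriv w (x z) ^ 2) atTop (nhds (2 * F 1 + c)) := by
      simp only [hc]
      exact ((((hF 1).continuousAt.tendsto.comp (htop.comp hxt)).const_mul 2).add_const c)
    have := tendsto_nhds_unique h1 h2
    rw [hF1] at this
    linarith
  have hE : ∀ z, deriv w z ^ 2 = 2 * F (w z) := fun z => by rw [hc, hc0, add_zero]
  have hf1' : ContDiff ℝ 1 f := hfs.of_le (by exact_mod_cast le_top)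
  have hn1 : ∀ z, w z ≠ 1 := fun z hz => by
    have := ne_aux f F w 1 hf1' hF hwd hE hf1 hF1 z hz
    rw [hw0] at this; norm_num at this
  have hnm1 : ∀ z, w z ≠ -1 := fun z hz => by
    have := ne_aux f F w (-1) hf1' hF hwd hE hfm1 hFm1 z hz
    rw [hw0] at this; norm_num at this
  have hlt : ∀ z, w z < 1 := by
    intro z
    by_contra! h
    obtain ⟨y, hy⟩ := mem_range_of_exists_le_of_exists_ge hwd.continuous
      ⟨0, by rw [hw0]; exact zero_le_one⟩ ⟨z, h⟩
    exact hn1 y hy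
  have hgt : ∀ z, -1 < w z := by
    intro z
    by_contra! h
    obtain ⟨y, hy⟩ := mem_range_of_exists_le_of_exists_ge hwd.continuous
      ⟨z, h⟩ ⟨0, by rw [hw0]; norm_num⟩
    exact hnm1 y hy
  have hne : ∀ z, deriv w z ≠ 0 := by
    intro z h
    have h1 := hE z
    have h2 : 0 < F (w z) := (hI (w z) ⟨hgt z, hlt z⟩).2
    rw [h] at h1
    norm_num at h1
    linarith
  intro z
  by_contra! hz
  have hneg : ∀ y, deriv w y ≤ 0 := by
    intro y
    by_contra! h
    obtain ⟨t, ht⟩ := mem_range_of_exists_le_of_exists_ge hdwd.continuous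
      ⟨z, hz⟩ ⟨y, h.le⟩
    exact hne t ht
  have hanti := antitone_of_deriv_nonpos hwd hneg
  have : (1 : ℝ) ≤ 0 := le_of_tendsto htop (by
    filter_upwards [eventually_ge_atTop 0] with y hy
    rw [← hw0]
    exact hanti hy)
  norm_num at this
end

section
/- Let f : ℝ → ℝ satisfy the double-well conditions, let w be a solution of the standing-wave problem, and fix α with 0 < α < min{√(f'(−1)), √(f'(1))}. Then for every integer n ≥ 1 there exists a constant Cₙ > 0 such that |w(z)² − 1| + |w^{(n)}(z)| ≤ Cₙ e^{−α|z|} for all z ∈ ℝ. -/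
open Filter

open Asymptotics Topology

/-- Maximum principle on a half line. -/
lemma sw_max_principle (h h1 h2 : ℝ → ℝ) (H1 : ∀ z, HasDerivAt h (h1 z) z)
    (H2 : ∀ z, HasDerivAt h1 (h2 z) z) (z0 : ℝ) (hz0 : h z0 ≤ 0)
    (hlim : Tendsto h atTop (𝓝 0)) (hpos : ∀ z, z0 < z → 0 < h z → 0 < h2 z) :
    ∀ z, z0 ≤ z → h z ≤ 0 := by
  intro z1 hz1
  by_contra! hc
  have hcont : Continuous h := continuous_iff_continuousAt.2 fun z => (H1 z).continuousAt
  obtain ⟨M, hM⟩ := eventually_atTop.1 (hlim.eventually_lt_const hc)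
  obtain ⟨m, hm, hmax⟩ := (isCompact_Icc (a := z0) (b := max M z1)).exists_isMaxOn
    ⟨z1, hz1, le_max_right _ _⟩ hcont.continuousOn
  have hm1 : h z1 ≤ h m := hmax ⟨hz1, le_max_right _ _⟩
  have hglob : ∀ z, z0 ≤ z → h z ≤ h m := by
    intro z hz
    rcases le_total z (max M z1) with h' | h'
    · exact hmax ⟨hz, h'⟩
    · exact ((hM z ((le_max_left _ _).trans h')).le).trans hm1
  have hmz : z0 < m := by
    rcases hm.1.lt_or_eq with h' | h'
    · exact h'
    · rw [← h'] at hm1; linarith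
  have hlm : IsLocalMax h m := by
    filter_upwards [lt_mem_nhds hmz] with z hz using hglob z hz.le
  have hd : deriv h = h1 := funext fun z => (H1 z).deriv
  have hdd : deriv h1 = h2 := funext fun z => (H2 z).deriv
  have hp := hpos m hmz (hc.trans_le hm1)
  have hlmin : IsLocalMin h m := by
    apply isLocalMin_of_deriv_deriv_pos
    · rw [hd, hdd]; exact hp
    · exact hlm.deriv_eq_zero
    · exact hcont.continuousAt
  have hconst : h =ᶠ[𝓝 m] fun _ => h m := by
    filter_upwards [hlm, hlmin] with z a b using le_antisymm a b
  have e1 : deriv h =ᶠ[𝓝 m] fun _ => 0 := by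
    have := hconst.deriv
    simpa using this
  have e2 := e1.deriv_eq
  rw [hd, hdd] at e2
  simp at e2
  linarith

/-- One-sided exponential bound. -/
lemma sw_one_sided (v v1 v2 : ℝ → ℝ) (H1 : ∀ z, HasDerivAt v (v1 z) z)
    (H2 : ∀ z, HasDerivAt v1 (v2 z) z) (α z0 A : ℝ) (hα : 0 < α) (hA : 0 < A)
    (hlim : Tendsto v atTop (𝓝 0)) (hA0 : v z0 ≤ A * Real.exp (-α * z0))
    (hpos : ∀ z, z0 < z → 0 < v z → α ^ 2 * v z ≤ v2 z) :
    ∀ z, z0 ≤ z → v z ≤ A * Real.exp (-α * z) := by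
  have E : ∀ z, HasDerivAt (fun z => Real.exp (-α * z)) (-α * Real.exp (-α * z)) z := by
    intro z
    have := ((hasDerivAt_id z).const_mul (-α)).exp
    simpa [mul_comm] using this
  have elim : Tendsto (fun z => Real.exp (-α * z)) atTop (𝓝 0) := by
    apply Real.tendsto_exp_atBot.comp
    exact tendsto_id.const_mul_atTop_of_neg (by linarith)
  have key := sw_max_principle (fun z => v z - A * Real.exp (-α * z))
    (fun z => v1 z - A * (-α * Real.exp (-α * z)))
    (fun z => v2 z - A * (-α * (-α * Real.exp (-α * z))))
    (fun z => (H1 z).sub ((E z).const_mul A))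
    (fun z => (H2 z).sub (((E z).const_mul (-α)).const_mul A)) z0 (by simpa using hA0)
    (by simpa using hlim.sub (elim.const_mul A))
    (by
      intro z hz hp
      have e := Real.exp_pos (-α * z)
      have hAe := mul_pos hA e
      have := hpos z hz (by linarith)
      have h3 : 0 < α ^ 2 * (v z - A * Real.exp (-α * z)) := by positivity
      nlinarith)
  intro z hz
  have := key z hz
  linarith

/-- Half-line decay. -/
lemma sw_half (g v v1 : ℝ → ℝ) (H1 : ∀ z, HasDerivAt v (v1 z) z)
    (H2 : ∀ z, HasDerivAt v1 (g (v z)) z) (d α : ℝ) (hα : 0 < α) (hd : α ^ 2 < d)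
    (hg0 : g 0 = 0) (hg : HasDerivAt g d 0) (hlim : Tendsto v atTop (𝓝 0)) :
    v =O[atTop] (fun z => Real.exp (-α * z)) ∧ v1 =O[atTop] (fun z => Real.exp (-α * z)) := by
  have hsm : ∀ᶠ x in 𝓝 (0:ℝ), |g x - d * x| ≤ (d - α ^ 2) * |x| := by
    have := hg.isLittleO.def (sub_pos.2 hd)
    simpa [hg0, mul_comm] using this
  obtain ⟨z0, hz0⟩ := eventually_atTop.1 (hlim.eventually hsm)
  have hA : 0 < (|v z0| + 1) * Real.exp (α * z0) := by positivity
  have hA0 : (|v z0| + 1) * Real.exp (α * z0) * Real.exp (-α * z0) = |v z0| + 1 := by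
    rw [mul_assoc, ← Real.exp_add]; simp
  set A := (|v z0| + 1) * Real.exp (α * z0) with hAdef
  have b1 := sw_one_sided v v1 (fun z => g (v z)) H1 H2 α z0 A hα hA hlim
    (by rw [hA0]; linarith [le_abs_self (v z0)])
    (by
      intro z hz hp
      have := (abs_le.1 (hz0 z hz.le)).1
      rw [abs_of_pos hp] at this
      nlinarith)
  have b2 := sw_one_sided (fun z => -v z) (fun z => -v1 z) (fun z => -g (v z))
    (fun z => (H1 z).neg) (fun z => (H2 z).neg) α z0 A hα hA (by simpa using hlim.neg)
    (by rw [hA0]; linarith [neg_abs_le (v z0)])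
    (by
      intro z hz hp
      have := (abs_le.1 (hz0 z hz.le)).2
      rw [abs_of_neg (by linarith)] at this
      nlinarith)
  have b : ∀ z, z0 ≤ z → |v z| ≤ A * Real.exp (-α * z) := fun z hz =>
    abs_le.2 ⟨by linarith [b2 z hz], b1 z hz⟩
  refine ⟨IsBigO.of_bound A ?_, ?_⟩
  · filter_upwards [eventually_ge_atTop z0] with z hz
    simpa [abs_of_pos (Real.exp_pos _)] using b z hz
  have hK : ∀ z, z0 ≤ z → |g (v z)| ≤ 2 * d * (A * Real.exp (-α * z)) := by
    intro z hz
    have h1 := hz0 z hz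
    have h2 : |g (v z)| ≤ |g (v z) - d * v z| + |d * v z| := by
      have := abs_add_le (g (v z) - d * v z) (d * v z)
      simpa using this
    have hdpos : 0 < d := by nlinarith [sq_nonneg α]
    rw [abs_mul, abs_of_pos hdpos] at h2
    have := b z hz
    have h3 : |g (v z)| ≤ 2 * d * |v z| := by nlinarith [abs_nonneg (v z), sq_nonneg α]
    exact h3.trans (by gcongr)
  refine IsBigO.of_bound (2 * A + 2 * d * A) ?_
  filter_upwards [eventually_ge_atTop z0] with z hz
  rw [Real.norm_eq_abs, Real.norm_eq_abs, abs_of_pos (Real.exp_pos _)]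
  have hdpos : 0 < d := by nlinarith [sq_nonneg α]
  have emono : ∀ y, z ≤ y → Real.exp (-α * y) ≤ Real.exp (-α * z) := by
    intro y hy
    apply Real.exp_le_exp.2
    nlinarith
  obtain ⟨c, hc, hce⟩ := exists_hasDerivAt_eq_slope v v1 (show z < z + 1 by linarith)
    (fun y _ => (H1 y).continuousAt.continuousWithinAt) (fun y _ => H1 y)
  obtain ⟨c', hc', hce'⟩ := exists_hasDerivAt_eq_slope v1 (fun z => g (v z)) hc.1
    (fun y _ => (H2 y).continuousAt.continuousWithinAt) (fun y _ => H2 y)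
  have q1 : |v1 c| ≤ 2 * A * Real.exp (-α * z) := by
    rw [hce]
    have := b z hz
    have h2 := b (z + 1) (by linarith)
    have h3 := mul_le_mul_of_nonneg_left (emono (z + 1) (by linarith)) hA.le
    have := abs_sub (v (z+1)) (v z)
    rw [add_sub_cancel_left, div_one]
    linarith
  have q2 : |v1 c - v1 z| ≤ 2 * d * A * Real.exp (-α * z) := by
    have hcz : 0 < c - z := by linarith [hc.1]
    have h0 : v1 c - v1 z = g (v c') * (c - z) := by
      rw [hce']; field_simp
    rw [h0, abs_mul, abs_of_pos hcz]
    have h1 := hK c' (by linarith [hc'.1])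
    have h3 := mul_le_mul_of_nonneg_left (emono c' hc'.1.le) (by positivity : 0 ≤ 2 * d * A)
    have h4 : c - z ≤ 1 := by linarith [hc.2]
    nlinarith [abs_nonneg (g (v c'))]
  have q3 : |v1 z| ≤ |v1 c| + |v1 c - v1 z| := by
    have := abs_sub (v1 c) (v1 c - v1 z)
    simpa using this
  linarith

/-- Smooth functions of `(w, w')` vanishing at an equilibrium decay. -/
lemma sw_comp (G : ℝ × ℝ → ℝ) (w w1 e : ℝ → ℝ) (a : ℝ) (l : Filter ℝ)
    (hG : DifferentiableAt ℝ G (a, 0)) (hG0 : G (a, 0) = 0)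
    (hw : (fun z => w z - a) =O[l] e) (hw1 : w1 =O[l] e) (he : Tendsto e l (𝓝 0)) :
    (fun z => G (w z, w1 z)) =O[l] e := by
  have t1 : Tendsto w l (𝓝 a) := by
    have := (hw.trans_tendsto he).add_const a
    simpa using this
  have t2 : Tendsto w1 l (𝓝 0) := hw1.trans_tendsto he
  have t : Tendsto (fun z => (w z, w1 z)) l (𝓝 (a, 0)) := t1.prodMk_nhds t2
  have h := hG.isBigO_sub.comp_tendsto t
  have h' : (fun z => G (w z, w1 z)) =O[l] (fun z => ((w z - a, w1 z) : ℝ × ℝ)) := by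
    simpa [Function.comp_def, hG0] using h
  exact h'.trans (hw.prod_left hw1)

/-- Passing from the two tails to a global bound. -/
lemma sw_global (F : ℝ → ℝ) (hF : Continuous F) (α : ℝ)
    (ht : F =O[atTop] (fun z => Real.exp (-α * z)))
    (hb : F =O[atBot] (fun z => Real.exp (α * z))) :
    ∃ C : ℝ, 0 < C ∧ ∀ z, |F z| ≤ C * Real.exp (-α * |z|) := by
  obtain ⟨C1, h1⟩ := ht.bound
  obtain ⟨C2, h2⟩ := hb.bound
  obtain ⟨M1, h1⟩ := eventually_atTop.1 h1
  obtain ⟨M2, h2⟩ := eventually_atBot.1 h2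
  have hc : Continuous (fun z => |F z| * Real.exp (α * |z|)) := by fun_prop
  obtain ⟨C3, h3⟩ := (isCompact_Icc (a := min M2 0) (b := max M1 0)).bddAbove_image hc.continuousOn
  refine ⟨|C1| + |C2| + |C3| + 1, by positivity, fun z => ?_⟩
  have e := Real.exp_pos (-α * |z|)
  have a1 := mul_le_mul_of_nonneg_right (le_abs_self C1) e.le
  have a2 := mul_le_mul_of_nonneg_right (le_abs_self C2) e.le
  have a3 := mul_le_mul_of_nonneg_right (le_abs_self C3) e.le
  have c1 := mul_nonneg (abs_nonneg C1) e.le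
  have c2 := mul_nonneg (abs_nonneg C2) e.le
  have c3 := mul_nonneg (abs_nonneg C3) e.le
  rcases le_total (max M1 0) z with hz | hz
  · have := h1 z ((le_max_left _ _).trans hz)
    rw [Real.norm_eq_abs, Real.norm_eq_abs, abs_of_pos (Real.exp_pos _)] at this
    have hz' : |z| = z := abs_of_nonneg ((le_max_right _ _).trans hz)
    rw [hz'] at a1 a2 a3 c1 c2 c3 e ⊢
    linarith
  rcases le_total z (min M2 0) with hz2 | hz2
  · have := h2 z (hz2.trans (min_le_left _ _))
    rw [Real.norm_eq_abs, Real.norm_eq_abs, abs_of_pos (Real.exp_pos _)] at this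
    have hz' : |z| = -z := abs_of_nonpos (hz2.trans (min_le_right _ _))
    rw [hz', neg_mul_neg] at a1 a2 a3 c1 c2 c3 e ⊢
    linarith
  · have := h3 ⟨z, ⟨hz2, hz⟩, rfl⟩
    simp only at this
    have h4 := mul_le_mul_of_nonneg_right this e.le
    rw [mul_assoc, ← Real.exp_add] at h4
    simp at h4
    simp only [neg_mul] at *
    linarith

/-- All derivatives are smooth functions of `(w, w')` vanishing at the equilibria. -/
lemma sw_repr (f w w1 : ℝ → ℝ) (hf : ContDiff ℝ (⊤ : ℕ∞) f) (f1 : f 1 = 0) (f2 : f (-1) = 0)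
    (H1 : ∀ z, HasDerivAt w (w1 z) z) (H2 : ∀ z, HasDerivAt w1 (f (w z)) z) (n : ℕ) :
    ∃ G : ℝ × ℝ → ℝ, ContDiff ℝ (⊤ : ℕ∞) G ∧ G (1, 0) = 0 ∧ G (-1, 0) = 0 ∧
      iteratedDeriv (n + 1) w = fun z => G (w z, w1 z) := by
  induction n with
  | zero =>
    refine ⟨Prod.snd, contDiff_snd, rfl, rfl, ?_⟩
    rw [zero_add, iteratedDeriv_one]
    exact funext fun z => (H1 z).deriv
  | succ n ih =>
    obtain ⟨G, hG, g1, g2, hr⟩ := ih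
    refine ⟨fun p => fderiv ℝ G p (p.2, f p.1), ?_, ?_, ?_, ?_⟩
    · apply ContDiff.clm_apply
      · exact hG.fderiv_right (by simp)
      · exact contDiff_snd.prodMk (hf.comp contDiff_fst)
    · simp only [f1]; exact map_zero _
    · simp only [f2]; exact map_zero _
    · rw [iteratedDeriv_succ, hr]
      funext z
      have hd : HasFDerivAt G (fderiv ℝ G (w z, w1 z)) (w z, w1 z) :=
        (hG.differentiable (by simp) _).hasFDerivAt
      exact (hd.comp_hasDerivAt z ((H1 z).prodMk (H2 z))).deriv

/-- Exponential decay of `w² - 1` and of all derivatives of the standing wave: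
for `0 < α < min {√(f'(-1)), √(f'(1))}` and every `n ≥ 1` there is `Cₙ > 0` with
`|w(z)² - 1| + |w⁽ⁿ⁾(z)| ≤ Cₙ e^{-α|z|}` for all `z`. -/
theorem standingWave_exponential_decay (f w : ℝ → ℝ) (hf : DoubleWell f)
    (hw : StandingWave f w) (α : ℝ) (hα : 0 < α)
    (hα' : α < min (Real.sqrt (deriv f (-1))) (Real.sqrt (deriv f 1))) :
    ∀ n : ℕ, 1 ≤ n → ∃ C : ℝ, 0 < C ∧
      ∀ z : ℝ, |(w z) ^ 2 - 1| + |iteratedDeriv n w z| ≤ C * Real.exp (-α * |z|) := by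
  obtain ⟨fs, f1, f2, -, -, -⟩ := hf
  obtain ⟨wc, weq, -, wt, wb⟩ := hw
  obtain ⟨hm, hp⟩ := lt_min_iff.1 hα'
  have hm2 : α ^ 2 < deriv f (-1) := (Real.lt_sqrt hα.le).1 hm
  have hp2 : α ^ 2 < deriv f 1 := (Real.lt_sqrt hα.le).1 hp
  have H1 : ∀ z, HasDerivAt w (deriv w z) z := fun z =>
    (wc.differentiable (by simp) z).hasDerivAt
  have wc1 : ContDiff ℝ 1 (deriv w) := by
    have : ContDiff ℝ (1 + 1) w := by simpa [one_add_one_eq_two] using wc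
    exact (contDiff_succ_iff_deriv.1 this).2.2
  have H2 : ∀ z, HasDerivAt (deriv w) (f (w z)) z := fun z => by
    have := (wc1.differentiable (by simp) z).hasDerivAt
    have h := weq z
    rwa [show deriv (deriv w) z = f (w z) by linarith] at this
  have fd : ∀ x, HasDerivAt f (deriv f x) x := fun x =>
    (fs.differentiable (by simp) x).hasDerivAt
  obtain ⟨t1, t2⟩ := sw_half (fun x => f (x + 1)) (fun z => w z - 1) (deriv w)
    (fun z => (H1 z).sub_const 1) (fun z => by simpa using H2 z) (deriv f 1) α hα hp2
    (by simpa using f1) (by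
      have := fd (0 + 1)
      have := this.comp_add_const 0 1
      simpa using this) (by simpa using wt.sub_const 1)
  obtain ⟨b1, b2⟩ := sw_half (fun x => f (x + -1)) (fun z => w (-z) - -1) (fun z => -deriv w (-z))
    (fun z => by
      have := (H1 (-z)).comp z (hasDerivAt_neg z)
      simpa using this.sub_const (-1))
    (fun z => by
      have := ((H2 (-z)).comp z (hasDerivAt_neg z)).neg
      have h3 : HasDerivAt (fun z => -deriv w (-z)) (-(f (w (-z)) * -1)) z := this
      simpa using h3) (deriv f (-1)) α hα hm2
    (by simpa using f2) (by
      have := fd (0 + -1)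
      have := this.comp_add_const 0 (-1)
      simpa using this) (by
        have := (wb.comp tendsto_neg_atTop_atBot).sub_const (-1)
        simpa using this)
  have b1' : (fun z => w z - -1) =O[atBot] (fun z => Real.exp (α * z)) := by
    have := b1.comp_tendsto tendsto_neg_atBot_atTop
    simpa [Function.comp_def] using this
  have b2' : deriv w =O[atBot] (fun z => Real.exp (α * z)) := by
    have := b2.comp_tendsto tendsto_neg_atBot_atTop
    simpa [Function.comp_def] using this
  have et : Tendsto (fun z => Real.exp (-α * z)) atTop (𝓝 0) :=
    Real.tendsto_exp_atBot.comp (tendsto_id.const_mul_atTop_of_neg (by linarith))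
  have eb : Tendsto (fun z => Real.exp (α * z)) atBot (𝓝 0) :=
    Real.tendsto_exp_atBot.comp (tendsto_id.const_mul_atBot hα)
  have main : ∀ G : ℝ × ℝ → ℝ, ContDiff ℝ (⊤ : ℕ∞) G → G (1, 0) = 0 → G (-1, 0) = 0 →
      ∃ C : ℝ, 0 < C ∧ ∀ z, |G (w z, deriv w z)| ≤ C * Real.exp (-α * |z|) := by
    intro G hG g1 g2
    have hGd : Differentiable ℝ G := hG.differentiable (by simp)
    apply sw_global (fun z => G (w z, deriv w z))
    · exact hG.continuous.comp (wc.continuous.prodMk wc1.continuous)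
    · exact sw_comp G w _ _ 1 _ (hGd _) g1 t1 t2 et
    · exact sw_comp G w _ _ (-1) _ (hGd _) g2 b1' b2' eb
  intro n hn
  obtain ⟨m, rfl⟩ := Nat.exists_eq_add_of_le' hn
  obtain ⟨G, hG, g1, g2, hr⟩ := sw_repr f w (deriv w) fs f1 f2 H1 H2 m
  obtain ⟨C, hC, h⟩ := main G hG g1 g2
  obtain ⟨C', hC', h'⟩ := main (fun p => p.1 ^ 2 - 1) (by fun_prop) (by norm_num) (by norm_num)
  refine ⟨C' + C, by positivity, fun z => ?_⟩
  rw [hr, add_mul]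
  exact add_le_add (h' z) (h z)
end

section
/- Let C be an elasticity tensor, let E* ∈ ℝ^{d×d}, let ν ∈ ℝ^d with |ν| = 1, and let A⁺, A⁻ ∈ ℝ^{d×d} and w ∈ ℝ^d satisfy A⁺ − A⁻ = w ⊗ ν and (C(A⁺ − A⁻)) ν = 2 (C E*) ν. Define S⁺ = C(A⁺ − E*), S⁻ = C(A⁻ + E*), W⁺ = ½ (A⁺ − E*) : C(A⁺ − E*), and W⁻ = ½ (A⁻ + E*) : C(A⁻ + E*). Then (W⁺ − W⁻) − ν · (((A⁺)ᵀ S⁺ − (A⁻)ᵀ S⁻) ν) = −(A⁺ + A⁻) : C E*. -/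
open Matrix

/-- The action of a fourth-order tensor `𝓒` on a matrix `A`:
`(𝓒A)_{ij} = ∑_{i',j'} 𝓒_{iji'j'} A_{i'j'}`. -/
def tensApply {d : ℕ} (𝓒 : Fin d → Fin d → Fin d → Fin d → ℝ)
    (A : Matrix (Fin d) (Fin d) ℝ) : Matrix (Fin d) (Fin d) ℝ :=
  Matrix.of fun i j => ∑ i', ∑ j', 𝓒 i j i' j' * A i' j'

/-- The Frobenius pairing `A : B = ∑_{i,j} A_{ij} B_{ij}`. -/
def ddot {d : ℕ} (A B : Matrix (Fin d) (Fin d) ℝ) : ℝ := ∑ i, ∑ j, A i j * B i j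

theorem tA_add {d : ℕ} (c : Fin d → Fin d → Fin d → Fin d → ℝ) (A B : Matrix (Fin d) (Fin d) ℝ) :
    tensApply c (A + B) = tensApply c A + tensApply c B := by
  ext i j
  simp [tensApply, mul_add, Finset.sum_add_distrib]

theorem tA_sub {d : ℕ} (c : Fin d → Fin d → Fin d → Fin d → ℝ) (A B : Matrix (Fin d) (Fin d) ℝ) :
    tensApply c (A - B) = tensApply c A - tensApply c B := by
  ext i j
  simp [tensApply, mul_sub, Finset.sum_sub_distrib]

theorem dd_add_left {d : ℕ} (A B X : Matrix (Fin d) (Fin d) ℝ) :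
    ddot (A + B) X = ddot A X + ddot B X := by
  simp [ddot, add_mul, Finset.sum_add_distrib]

theorem dd_sub_left {d : ℕ} (A B X : Matrix (Fin d) (Fin d) ℝ) :
    ddot (A - B) X = ddot A X - ddot B X := by
  simp [ddot, sub_mul, Finset.sum_sub_distrib]

theorem dd_add_right {d : ℕ} (A B X : Matrix (Fin d) (Fin d) ℝ) :
    ddot X (A + B) = ddot X A + ddot X B := by
  simp [ddot, mul_add, Finset.sum_add_distrib]

theorem dd_sub_right {d : ℕ} (A B X : Matrix (Fin d) (Fin d) ℝ) :
    ddot X (A - B) = ddot X A - ddot X B := by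
  simp [ddot, mul_sub, Finset.sum_sub_distrib]

theorem dd_symm {d : ℕ} (c : Fin d → Fin d → Fin d → Fin d → ℝ)
    (h : ∀ i j i' j', c i j i' j' = c i' j' i j) (A B : Matrix (Fin d) (Fin d) ℝ) :
    ddot A (tensApply c B) = ddot B (tensApply c A) := by
  have key : ∀ F : Fin d → Fin d → Fin d → Fin d → ℝ,
      ∑ i, ∑ j, ∑ k, ∑ l, F i j k l = ∑ i, ∑ j, ∑ k, ∑ l, F k l i j := by
    intro F
    have := Finset.sum_comm (s := (Finset.univ : Finset (Fin d × Fin d)))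
      (t := (Finset.univ : Finset (Fin d × Fin d))) (f := fun x y => F x.1 x.2 y.1 y.2)
    simpa only [Fintype.sum_prod_type] using this
  simp only [ddot, tensApply, Matrix.of_apply, Finset.mul_sum]
  rw [key]
  refine Finset.sum_congr rfl fun i _ => Finset.sum_congr rfl fun j _ =>
    Finset.sum_congr rfl fun k _ => Finset.sum_congr rfl fun l _ => ?_
  rw [h i j k l]
  ring

theorem dd_vec {d : ℕ} (w v : Fin d → ℝ) (S : Matrix (Fin d) (Fin d) ℝ) :
    ddot (vecMulVec w v) S = w ⬝ᵥ (S *ᵥ v) := by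
  simp only [ddot, vecMulVec_apply, dotProduct, mulVec, Finset.mul_sum]
  refine Finset.sum_congr rfl fun i _ => Finset.sum_congr rfl fun j _ => ?_
  ring

/-- Jump identity at the interface: if `A⁺ - A⁻ = w⊗ν` and
`(𝓒(A⁺ - A⁻))ν = 2(𝓒E*)ν` with `|ν| = 1`, then
`(W⁺ - W⁻) - ν·(((A⁺)ᵀS⁺ - (A⁻)ᵀS⁻)ν) = -(A⁺ + A⁻) : 𝓒E*`, where
`S± = 𝓒(A± ∓ E*)` and `W± = ½(A± ∓ E*) : 𝓒(A± ∓ E*)`. -/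
theorem interface_energy_jump (d : ℕ) (hd : 1 ≤ d)
    (𝓒 : Fin d → Fin d → Fin d → Fin d → ℝ)
    (hsym₁ : ∀ i j i' j', 𝓒 i j i' j' = 𝓒 i j j' i')
    (hsym₂ : ∀ i j i' j', 𝓒 i j i' j' = 𝓒 j i i' j')
    (hsym₃ : ∀ i j i' j', 𝓒 i j i' j' = 𝓒 i' j' i j)
    (Estar Ap Am : Matrix (Fin d) (Fin d) ℝ) (ν w : Fin d → ℝ)
    (hν : ν ⬝ᵥ ν = 1)
    (hjump : Ap - Am = vecMulVec w ν)
    (hstress : tensApply 𝓒 (Ap - Am) *ᵥ ν = (2 : ℝ) • (tensApply 𝓒 Estar *ᵥ ν)) :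
    ((1 / 2 : ℝ) * ddot (Ap - Estar) (tensApply 𝓒 (Ap - Estar)) -
        (1 / 2 : ℝ) * ddot (Am + Estar) (tensApply 𝓒 (Am + Estar))) -
      ν ⬝ᵥ ((Apᵀ * tensApply 𝓒 (Ap - Estar) - Amᵀ * tensApply 𝓒 (Am + Estar)) *ᵥ ν) =
      -(ddot (Ap + Am) (tensApply 𝓒 Estar)) := by
  have hP : Ap = Am + vecMulVec w ν := by rw [← hjump]; abel
  rw [hjump] at hstress
  have hDD : ddot (vecMulVec w ν) (tensApply 𝓒 (vecMulVec w ν)) =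
      2 * ddot (vecMulVec w ν) (tensApply 𝓒 Estar) := by
    rw [dd_vec, hstress, dd_vec, dotProduct_smul, smul_eq_mul]
  have hS : tensApply 𝓒 (Ap - Estar) *ᵥ ν = tensApply 𝓒 (Am + Estar) *ᵥ ν := by
    rw [hP, tA_sub, tA_add, tA_add, sub_mulVec, add_mulVec, add_mulVec, hstress, two_smul]
    abel
  have hT : ν ⬝ᵥ ((Apᵀ * tensApply 𝓒 (Ap - Estar) - Amᵀ * tensApply 𝓒 (Am + Estar)) *ᵥ ν) =
      ddot (vecMulVec w ν) (tensApply 𝓒 (Am + Estar)) := by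
    rw [sub_mulVec, ← mulVec_mulVec, ← mulVec_mulVec, hS, ← sub_mulVec, ← transpose_sub, hjump,
      dotProduct_mulVec, vecMul_transpose, dd_vec, vecMulVec_mulVec, hν]
    simp
  rw [hT, hP]
  have s1 := dd_symm 𝓒 hsym₃ Am Estar
  have s2 := dd_symm 𝓒 hsym₃ Am (vecMulVec w ν)
  have s3 := dd_symm 𝓒 hsym₃ Estar (vecMulVec w ν)
  simp only [tA_add, tA_sub, dd_add_left, dd_sub_left, dd_add_right, dd_sub_right]
  linarith
end

section
/- Let f : ℝ → ℝ satisfy the double-well conditions, let θ₀ be the unique solution of the standing-wave problem, and set σ := ½ ∫_ℝ (θ₀'(z))² dz. Then there exists a unique bounded function θ₁ ∈ C²(ℝ) such that θ₁''(z) − f'(θ₀(z)) θ₁(z) = σ − θ₀'(z) for all z ∈ ℝ and θ₁(0) = 0. -/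
open Filter

lemma aux_mono_ge {h h' : ℝ → ℝ} {R : ℝ} (hd : ∀ z, HasDerivAt h (h' z) z)
    (hn : ∀ z, R < z → 0 ≤ h' z) : MonotoneOn h (Set.Ici R) := by
  apply monotoneOn_of_deriv_nonneg (convex_Ici R)
  · exact fun z _ => (hd z).continuousAt.continuousWithinAt
  · exact fun z _ => (hd z).differentiableAt.differentiableWithinAt
  · intro z hz
    rw [interior_Ici] at hz
    rw [(hd z).deriv]
    exact hn z hz

lemma aux_nonpos {h h' : ℝ → ℝ} {R : ℝ} (hd : ∀ z, HasDerivAt h (h' z) z)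
    (hn : ∀ z, R < z → 0 ≤ h' z) (hl : Tendsto h atTop (nhds 0)) :
    ∀ z, R ≤ z → h z ≤ 0 := by
  intro z hz
  have hm := aux_mono_ge hd hn
  apply ge_of_tendsto hl
  filter_upwards [eventually_ge_atTop z] with y hy
  exact hm hz (le_trans hz hy) hy

/-- exponential-type decay of a positive decaying solution -/
lemma aux_decay {w w1 q : ℝ → ℝ} {R c : ℝ} (hc : 0 < c) (hw : ∀ z, 0 < w z)
    (hdw : ∀ z, HasDerivAt w (w1 z) z) (hdw1 : ∀ z, HasDerivAt w1 (q z * w z) z)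
    (hq : ∀ z, R < z → c ^ 2 ≤ q z)
    (lw : Tendsto w atTop (nhds 0)) (lw1 : Tendsto w1 atTop (nhds 0)) :
    ∀ z, R ≤ z → w1 z ≤ -c * w z := by
  have he : ∀ z : ℝ, HasDerivAt (fun z => Real.exp (-c * z)) (Real.exp (-c * z) * (-c)) z := by
    intro z
    have := ((hasDerivAt_id z).const_mul (-c)).exp
    simpa using this
  have hle : Tendsto (fun z : ℝ => Real.exp (-c * z)) atTop (nhds 0) := by
    apply Real.tendsto_exp_atBot.comp
    exact tendsto_id.const_mul_atTop_of_neg (by linarith)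
  have key := aux_nonpos (R := R) (h := fun z => Real.exp (-c * z) * (w1 z + c * w z))
    (h' := fun z => Real.exp (-c * z) * (-c) * (w1 z + c * w z)
      + Real.exp (-c * z) * (q z * w z + c * w1 z))
    (fun z => (he z).mul ((hdw1 z).add ((hdw z).const_mul c))) ?_ ?_
  · intro z hz
    have h1 := key z hz
    have h2 := Real.exp_pos (-c * z)
    have h3 : w1 z + c * w z ≤ 0 := by
      by_contra hcon
      push Not at hcon
      exact absurd h1 (not_le.mpr (mul_pos h2 hcon))
    linarith
  · intro z hz
    have h2 := Real.exp_pos (-c * z)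
    have h3 : 0 ≤ Real.exp (-c * z) * ((q z - c ^ 2) * w z) :=
      mul_nonneg h2.le (mul_nonneg (by linarith [hq z hz]) (hw z).le)
    nlinarith [h3]
  · have := hle.mul (lw1.add (lw.const_mul c))
    simpa using this

lemma aux_half {w w1 q g G v : ℝ → ℝ} {K a : ℝ} (hw : ∀ z, 0 < w z)
    (hdw : ∀ z, HasDerivAt w (w1 z) z) (hdw1 : ∀ z, HasDerivAt w1 (q z * w z) z)
    (ha : 0 < a) (hq : Tendsto q atTop (nhds a))
    (lw : Tendsto w atTop (nhds 0)) (lw1 : Tendsto w1 atTop (nhds 0))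
    (hg : ∀ z, |g z| ≤ K) (hdG : ∀ z, HasDerivAt G (g z * w z) z)
    (lG : Tendsto G atTop (nhds 0)) (hdv : ∀ z, HasDerivAt v (G z / w z ^ 2) z) :
    ∃ M, ∀ z, 0 ≤ z → |w z * v z| ≤ M := by
  have hK : 0 ≤ K := le_trans (abs_nonneg _) (hg 0)
  obtain ⟨c, hc, hca⟩ : ∃ c : ℝ, 0 < c ∧ c ^ 2 = a / 2 :=
    ⟨Real.sqrt (a / 2), Real.sqrt_pos.mpr (by linarith), Real.sq_sqrt (by linarith)⟩
  have ev1 : ∀ᶠ z in atTop, c ^ 2 ≤ q z := by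
    rw [hca]; exact hq.eventually (Ici_mem_nhds (by linarith))
  have ev2 : ∀ᶠ z in atTop, w z ≤ 1 := lw.eventually (Iic_mem_nhds (by norm_num))
  obtain ⟨R, hR⟩ := eventually_atTop.1 (ev1.and ev2)
  have hdec := aux_decay hc hw hdw hdw1 (fun z hz => (hR z hz.le).1) lw lw1
  -- bounds for G
  have hG1 : ∀ z, R ≤ z → G z - K / c * w z ≤ 0 := by
    apply aux_nonpos (h' := fun z => g z * w z - K / c * w1 z)
    · exact fun z => (hdG z).sub ((hdw z).const_mul _)
    · intro z hz
      have h1 := mul_le_mul_of_nonneg_left (hdec z hz.le) (div_nonneg hK hc.le)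
      have h2 : K / c * (-c * w z) = -(K * w z) := by field_simp
      have h3 := mul_le_mul_of_nonneg_right (abs_le.1 (hg z)).1 (hw z).le
      linarith
    · simpa using lG.sub (lw.const_mul (K / c))
  have hG2 : ∀ z, R ≤ z → -G z - K / c * w z ≤ 0 := by
    apply aux_nonpos (h' := fun z => -(g z * w z) - K / c * w1 z)
    · exact fun z => (hdG z).neg.sub ((hdw z).const_mul _)
    · intro z hz
      have h1 := mul_le_mul_of_nonneg_left (hdec z hz.le) (div_nonneg hK hc.le)
      have h2 : K / c * (-c * w z) = -(K * w z) := by field_simp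
      have h3 := mul_le_mul_of_nonneg_right (abs_le.1 (hg z)).2 (hw z).le
      linarith
    · simpa using lG.neg.sub (lw.const_mul (K / c))
  have hdi : ∀ z, HasDerivAt (fun z => K / c ^ 2 * (w z)⁻¹) (K / c ^ 2 * (-w1 z / w z ^ 2)) z :=
    fun z => ((hdw z).inv (hw z).ne').const_mul _
  have hcmp : ∀ z, R ≤ z → K / c * w z ≤ K / c ^ 2 * (-w1 z) := by
    intro z hz
    have h1 := mul_le_mul_of_nonneg_left (hdec z hz) (div_nonneg hK (sq_nonneg c))
    have h2 : K / c ^ 2 * (-c * w z) = -(K / c * w z) := by field_simp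
    linarith
  have hv1 : MonotoneOn (fun z => K / c ^ 2 * (w z)⁻¹ - v z) (Set.Ici R) := by
    apply aux_mono_ge (fun z => (hdi z).sub (hdv z))
    intro z hz
    have : K / c ^ 2 * (-w1 z / w z ^ 2) - G z / w z ^ 2
      = (K / c ^ 2 * (-w1 z) - G z) / w z ^ 2 := by ring
    rw [this]
    exact div_nonneg (by linarith [hcmp z hz.le, hG1 z hz.le]) (sq_nonneg _)
  have hv2 : MonotoneOn (fun z => K / c ^ 2 * (w z)⁻¹ + v z) (Set.Ici R) := by
    apply aux_mono_ge (fun z => (hdi z).add (hdv z))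
    intro z hz
    have : K / c ^ 2 * (-w1 z / w z ^ 2) + G z / w z ^ 2
      = (K / c ^ 2 * (-w1 z) + G z) / w z ^ 2 := by ring
    rw [this]
    exact div_nonneg (by linarith [hcmp z hz.le, hG2 z hz.le]) (sq_nonneg _)
  have hcont : Continuous (fun z => w z * v z) :=
    (continuous_iff_continuousAt.2 fun z => (hdw z).continuousAt).mul
      (continuous_iff_continuousAt.2 fun z => (hdv z).continuousAt)
  obtain ⟨M, hM⟩ := (isCompact_Icc (a := (0:ℝ)) (b := R)).exists_bound_of_continuousOn
    hcont.continuousOn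
  refine ⟨max M (K / c ^ 2 + |v R|), fun z hz => ?_⟩
  rcases le_total z R with h | h
  · exact le_max_of_le_left (hM z ⟨hz, h⟩)
  · apply le_max_of_le_right
    have e1 := hv1 (Set.self_mem_Ici) h h
    have e2 := hv2 (Set.self_mem_Ici) h h
    simp only at e1 e2
    have hp : 0 ≤ K / c ^ 2 * (w R)⁻¹ :=
      mul_nonneg (div_nonneg hK (sq_nonneg c)) (inv_nonneg.2 (hw R).le)
    have hva : |v z| ≤ K / c ^ 2 * (w z)⁻¹ + |v R| := by
      rw [abs_le]
      constructor
      · linarith [neg_abs_le (v R)]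
      · linarith [le_abs_self (v R)]
    rw [abs_mul, abs_of_pos (hw z)]
    calc w z * |v z| ≤ w z * (K / c ^ 2 * (w z)⁻¹ + |v R|) :=
          mul_le_mul_of_nonneg_left hva (hw z).le
      _ = K / c ^ 2 + w z * |v R| := by
          have := (hw z).ne'
          field_simp
      _ ≤ K / c ^ 2 + 1 * |v R| := by
          have := mul_le_mul_of_nonneg_right (hR z h).2 (abs_nonneg (v R))
          linarith
      _ = _ := by ring

/-- points at infinity at which the derivative of a bounded function is bounded / small -/
lemma aux_seq {h h' : ℝ → ℝ} (hd : ∀ z, HasDerivAt h (h' z) z) :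
    ∃ x : ℕ → ℝ, Tendsto x atTop atTop ∧ ∀ n : ℕ, h' (x n) = h (n + 1) - h n := by
  have : ∀ n : ℕ, ∃ c : ℝ, (n : ℝ) < c ∧ h' c = h (n + 1) - h n := by
    intro n
    obtain ⟨c, hc, e⟩ := exists_hasDerivAt_eq_slope h h' (a := n) (b := n + 1) (by linarith)
      (fun z _ => (hd z).continuousAt.continuousWithinAt) (fun z _ => hd z)
    refine ⟨c, hc.1, ?_⟩
    rw [e]; simp
  choose x hx hx' using this
  exact ⟨x, tendsto_atTop_mono (fun n => (hx n).le) tendsto_natCast_atTop_atTop, hx'⟩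

lemma aux_const {h : ℝ → ℝ} (hd : ∀ z, HasDerivAt h 0 z) (x y : ℝ) : h x = h y :=
  is_const_of_deriv_eq_zero (fun z => (hd z).differentiableAt) (fun z => (hd z).deriv) x y

lemma aux_primitive {h : ℝ → ℝ} (hc : Continuous h) (a z : ℝ) :
    HasDerivAt (fun u => ∫ s in a..u, h s) (h z) z :=
  intervalIntegral.integral_hasDerivAt_right (hc.intervalIntegrable _ _)
    (hc.stronglyMeasurableAtFilter _ _) hc.continuousAt

/-- properties of the standing wave -/
lemma aux_wave {f θ : ℝ → ℝ} (hf : DoubleWell f) (hθ : StandingWave f θ) :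
    (∀ z, θ z ∈ Set.Ioo (-1 : ℝ) 1) ∧ (∀ z, 0 < deriv θ z) ∧
    (∀ z, HasDerivAt θ (deriv θ z) z) ∧ (∀ z, HasDerivAt (deriv θ) (f (θ z)) z) ∧
    Tendsto (deriv θ) atTop (nhds 0) ∧ Tendsto (deriv θ) atBot (nhds 0) := by
  obtain ⟨hfs, f1, fm1, -, -, hF⟩ := hf
  obtain ⟨hc2, hode, h0, lt, lb⟩ := hθ
  have hfc : Continuous f := hfs.continuous
  have hθd : ∀ z, HasDerivAt θ (deriv θ z) z :=
    fun z => (hc2.differentiable (by norm_num) z).hasDerivAt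
  have hc1 : ContDiff ℝ 1 (deriv θ) := by
    have : ContDiff ℝ (1 + 1) θ := by simpa [one_add_one_eq_two] using hc2
    exact (contDiff_succ_iff_deriv.1 this).2.2
  have hwd : ∀ z, HasDerivAt (deriv θ) (f (θ z)) z := by
    intro z
    have h := (hc1.differentiable (by norm_num) z).hasDerivAt
    rwa [show deriv (deriv θ) z = f (θ z) by linarith [hode z]] at h
  have hθc : Continuous θ := hc2.continuous
  have hwc : Continuous (deriv θ) := hc1.continuous
  set F : ℝ → ℝ := fun u => ∫ s in (-1 : ℝ)..u, f s with hFdef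
  have hFd : ∀ u, HasDerivAt F (f u) u := aux_primitive hfc (-1)
  have hFc : Continuous F := continuous_iff_continuousAt.2 fun z => (hFd z).continuousAt
  have hFm1 : F (-1) = 0 := by simp [hFdef]
  have hF1 : F 1 = 0 := by
    have h1 := (hF 0 (by norm_num)).1
    have h2 := intervalIntegral.integral_add_adjacent_intervals
      (hfc.intervalIntegrable (μ := MeasureTheory.volume) (-1) 0) (hfc.intervalIntegrable 0 1)
    have h3 := intervalIntegral.integral_symm (f := f) (μ := MeasureTheory.volume) 0 1
    simp only [hFdef]
    linarith
  -- energy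
  have hEc : ∀ z, deriv θ z ^ 2 - 2 * F (θ z) = deriv θ 0 ^ 2 - 2 * F (θ 0) := by
    intro z
    refine aux_const (h := fun z => deriv θ z ^ 2 - 2 * F (θ z)) (fun y => ?_) z 0
    have := ((hwd y).pow 2).sub (((hFd (θ y)).comp y (hθd y)).const_mul 2)
    refine this.congr_deriv ?_
    simp only [Nat.cast_ofNat]
    ring
  have hE0 : deriv θ 0 ^ 2 - 2 * F (θ 0) = 0 := by
    obtain ⟨x, hx, hx'⟩ := aux_seq hθd
    have hn : Tendsto (fun n : ℕ => (n : ℝ)) atTop atTop := tendsto_natCast_atTop_atTop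
    have l1 : Tendsto (fun n => deriv θ (x n)) atTop (nhds 0) := by
      have := (lt.comp (tendsto_atTop_add_const_right _ (1:ℝ) hn)).sub (lt.comp hn)
      rw [sub_self] at this
      exact this.congr (fun n => (hx' n).symm)
    have l2 : Tendsto (fun n => F (θ (x n))) atTop (nhds 0) := by
      rw [← hF1]; exact (hFc.tendsto 1).comp (lt.comp hx)
    have l3 := (l1.pow 2).sub (l2.const_mul 2)
    simp only [hEc] at l3
    have := tendsto_nhds_unique l3 tendsto_const_nhds
    rw [← this]; norm_num
  have hE : ∀ z, deriv θ z ^ 2 = 2 * F (θ z) := fun z => by linarith [hEc z]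
  -- boundedness of θ
  obtain ⟨B, hB1, hB⟩ : ∃ B : ℝ, 1 ≤ B ∧ ∀ z, |θ z| ≤ B := by
    have e1 : ∀ᶠ z in atTop, |θ z| ≤ 2 :=
      lt.abs.eventually (Iic_mem_nhds (by norm_num))
    have e2 : ∀ᶠ z in atBot, |θ z| ≤ 2 :=
      lb.abs.eventually (Iic_mem_nhds (by norm_num))
    obtain ⟨R, hR⟩ := eventually_atTop.1 e1
    obtain ⟨S, hS⟩ := eventually_atBot.1 e2
    obtain ⟨M, hM⟩ := (isCompact_Icc (a := S) (b := R)).exists_bound_of_continuousOn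
      hθc.continuousOn
    refine ⟨max M 2, le_max_of_le_right (by norm_num), fun z => ?_⟩
    rcases le_total z S with h | h
    · exact le_max_of_le_right (hS z h)
    rcases le_total R z with h' | h'
    · exact le_max_of_le_right (hR z h')
    · exact le_max_of_le_left (hM z ⟨h, h'⟩)
  obtain ⟨L, hL⟩ := LocallyLipschitzOn.exists_lipschitzOnWith_of_compact
    (isCompact_Icc (a := -B) (b := B))
    ((ContDiff.locallyLipschitz (hfs.of_le (by exact_mod_cast le_top))).locallyLipschitzOn
      (s := Set.Icc (-B) B))
  have hne : ∀ e : ℝ, |e| = 1 → f e = 0 → F e = 0 → ∀ z, θ z ≠ e := by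
    intro e he hfe hFe z hz
    have hw0 : deriv θ z = 0 := by
      have := hE z
      rw [hz, hFe] at this
      simpa using this
    have hLip : LipschitzOnWith (max 1 L) (fun p : ℝ × ℝ => (p.2, f p.1))
        (Set.Icc (-B) B ×ˢ Set.univ) := by
      have h2 : LipschitzOnWith 1 (fun p : ℝ × ℝ => p.2) (Set.Icc (-B) B ×ˢ Set.univ) :=
        LipschitzWith.prod_snd.lipschitzOnWith
      have h1 : LipschitzOnWith (L * 1) (fun p : ℝ × ℝ => f p.1) (Set.Icc (-B) B ×ˢ Set.univ) :=
        hL.comp (LipschitzWith.prod_fst.lipschitzOnWith) (fun p hp => hp.1)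
      have := h2.prodMk h1
      simpa using this
    have hu := ODE_solution_unique_univ (v := fun _ (p : ℝ × ℝ) => (p.2, f p.1))
      (s := fun _ => Set.Icc (-B) B ×ˢ Set.univ) (f := fun t => (θ t, deriv θ t))
      (g := fun _ => (e, 0)) (t₀ := z) (fun _ => hLip)
      (fun t => ⟨(hθd t).prodMk (hwd t), ⟨abs_le.1 (hB t), trivial⟩⟩)
      (fun t => ⟨(hasDerivAt_const t ((e, 0) : ℝ × ℝ)).congr_deriv (by simp [hfe, Prod.ext_iff]),
        ⟨abs_le.1 (by simpa [he] using hB1), trivial⟩⟩)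
      (by simp [hz, hw0])
    have h00 := congrFun hu 0
    have : θ 0 = e := congrArg Prod.fst h00
    rw [h0] at this
    rw [← this] at he
    norm_num at he
  have hne1 := hne 1 (by norm_num) f1 hF1
  have hnem1 := hne (-1) (by norm_num) fm1 hFm1
  have hmem : ∀ z, θ z ∈ Set.Ioo (-1 : ℝ) 1 := by
    intro z
    constructor
    · by_contra hcon
      push Not at hcon
      obtain ⟨y, hy⟩ := mem_range_of_exists_le_of_exists_ge hθc ⟨z, hcon⟩
        ⟨0, by rw [h0]; norm_num⟩
      exact hnem1 y hy
    · by_contra hcon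
      push Not at hcon
      obtain ⟨y, hy⟩ := mem_range_of_exists_le_of_exists_ge hθc
        ⟨0, show θ 0 ≤ 1 by rw [h0]; norm_num⟩ ⟨z, hcon⟩
      exact hne1 y hy
  have hwne : ∀ z, deriv θ z ≠ 0 := by
    intro z hz
    have h1 := hE z
    have h2 := (hF (θ z) (hmem z)).2
    rw [hz] at h1
    have h3 : F (θ z) = ∫ s in (-1 : ℝ)..θ z, f s := rfl
    rw [← h3] at h2
    norm_num at h1
    linarith
  have hwpos : ∀ z, 0 < deriv θ z := by
    obtain ⟨y, hy0, hy⟩ : ∃ y, 0 < y ∧ 0 < θ y :=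
      ((eventually_gt_atTop 0).and (lt.eventually (Ioi_mem_nhds (by norm_num)))).exists
    obtain ⟨ξ, -, hξ⟩ := exists_hasDerivAt_eq_slope θ (deriv θ) hy0 hθc.continuousOn
      (fun z _ => hθd z)
    have hξp : 0 < deriv θ ξ := by
      rw [hξ, h0]; exact div_pos (by linarith) (by linarith)
    intro z
    by_contra hcon
    push Not at hcon
    obtain ⟨t, ht⟩ := mem_range_of_exists_le_of_exists_ge hwc ⟨z, hcon⟩ ⟨ξ, hξp.le⟩
    exact hwne t ht
  have hsq : ∀ z, deriv θ z = Real.sqrt (2 * F (θ z)) := by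
    intro z
    rw [← hE z, Real.sqrt_sq (hwpos z).le]
  have hcs : Continuous (fun u => Real.sqrt (2 * F u)) := by fun_prop
  refine ⟨hmem, hwpos, hθd, hwd, ?_, ?_⟩
  · have := (hcs.tendsto 1).comp lt
    simp only [hF1, mul_zero, Real.sqrt_zero] at this
    exact this.congr (fun z => (hsq z).symm)
  · have := (hcs.tendsto (-1)).comp lb
    simp only [hFm1, mul_zero, Real.sqrt_zero] at this
    exact this.congr (fun z => (hsq z).symm)

/-- With `σ := ½ ∫_ℝ (θ₀')²`, there is a unique bounded `θ₁ ∈ C²(ℝ)` with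
`θ₁'' - f'(θ₀) θ₁ = σ - θ₀'` on `ℝ` and `θ₁(0) = 0`. -/
theorem theta1_exists_unique (f θ₀ : ℝ → ℝ)
    (hf : DoubleWell f) (hθ₀ : StandingWave f θ₀) :
    ∃! θ₁ : ℝ → ℝ, ContDiff ℝ 2 θ₁ ∧ (∃ M : ℝ, ∀ z : ℝ, |θ₁ z| ≤ M) ∧
      (∀ z : ℝ, deriv (deriv θ₁) z - deriv f (θ₀ z) * θ₁ z =
        (1 / 2 * ∫ y : ℝ, (deriv θ₀ y) ^ 2) - deriv θ₀ z) ∧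
      θ₁ 0 = 0 := by
  obtain ⟨hmem, hw, hθd, hwd, lw, lwb⟩ := aux_wave hf hθ₀
  obtain ⟨hfs, f1, fm1, hp1, hpm1, -⟩ := hf
  obtain ⟨-, -, -, lt, lb⟩ := hθ₀
  have hfd : ∀ u, HasDerivAt f (deriv f u) u :=
    fun u => (hfs.differentiable (by simp) u).hasDerivAt
  have hf'c : Continuous (deriv f) := hfs.continuous_deriv (by exact_mod_cast le_top)
  have hθc : Continuous θ₀ := continuous_iff_continuousAt.2 fun z => (hθd z).continuousAt
  set w : ℝ → ℝ := deriv θ₀ with hwdef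
  have hwc : Continuous w := continuous_iff_continuousAt.2 fun z => (hwd z).continuousAt
  set w1 : ℝ → ℝ := fun z => f (θ₀ z) with hw1
  replace hwd : ∀ z, HasDerivAt w (w1 z) z := hwd
  set q : ℝ → ℝ := fun z => deriv f (θ₀ z) with hq
  have hqc : Continuous q := hf'c.comp hθc
  have hw1d : ∀ z, HasDerivAt w1 (q z * w z) z := fun z => (hfd (θ₀ z)).comp z (hθd z)
  have hw1c : Continuous w1 := hfs.continuous.comp hθc
  have lw1 : Tendsto w1 atTop (nhds 0) := by
    rw [← f1]; exact (hfs.continuous.tendsto 1).comp lt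
  have lw1b : Tendsto w1 atBot (nhds 0) := by
    rw [← fm1]; exact (hfs.continuous.tendsto (-1)).comp lb
  have lq : Tendsto q atTop (nhds (deriv f 1)) := (hf'c.tendsto 1).comp lt
  have lqb : Tendsto q atBot (nhds (deriv f (-1))) := (hf'c.tendsto (-1)).comp lb
  -- bound on w
  obtain ⟨B, hB⟩ : ∃ B : ℝ, ∀ z, |w z| ≤ B := by
    have e1 : ∀ᶠ z in atTop, |w z| ≤ 2 :=
      lw.abs.eventually (Iic_mem_nhds (by norm_num))
    have e2 : ∀ᶠ z in atBot, |w z| ≤ 2 :=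
      lwb.abs.eventually (Iic_mem_nhds (by norm_num))
    obtain ⟨R, hR⟩ := eventually_atTop.1 e1
    obtain ⟨S, hS⟩ := eventually_atBot.1 e2
    obtain ⟨M, hM⟩ := (isCompact_Icc (a := S) (b := R)).exists_bound_of_continuousOn
      hwc.continuousOn
    refine ⟨max M 2, fun z => ?_⟩
    rcases le_total z S with h | h
    · exact le_max_of_le_right (hS z h)
    rcases le_total R z with h' | h'
    · exact le_max_of_le_right (hR z h')
    · exact le_max_of_le_left (hM z ⟨h, h'⟩)
  have hwi : MeasureTheory.Integrable w := by
    refine MeasureTheory.integrable_of_intervalIntegral_norm_tendsto (1 - (-1))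
      (a := fun n : ℝ => -n) (b := fun n : ℝ => n) (l := atTop)
      (fun n => (hwc.integrableOn_Icc).mono_set Set.Ioc_subset_Icc_self)
      tendsto_neg_atTop_atBot tendsto_id ?_
    have h1 : ∀ n : ℝ, (∫ x in (-n)..n, ‖w x‖) = θ₀ n - θ₀ (-n) := by
      intro n
      rw [← intervalIntegral.integral_eq_sub_of_hasDerivAt (fun x _ => hθd x)
        (hwc.intervalIntegrable _ _)]
      exact intervalIntegral.integral_congr (fun x _ => abs_of_pos (hw x))
    simp only [h1]
    exact lt.sub (lb.comp tendsto_neg_atTop_atBot)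
  have hw2i : MeasureTheory.Integrable (fun z => w z ^ 2) := by
    have := hwi.mul_bdd (c := B) hwc.aestronglyMeasurable (Eventually.of_forall hB)
    simpa [sq] using this
  set σ : ℝ := 1 / 2 * ∫ y : ℝ, (w y) ^ 2 with hσ
  set g : ℝ → ℝ := fun z => σ - w z with hg
  have hgw : (fun z => g z * w z) = fun z => σ * w z - w z ^ 2 := by
    funext z; simp only [hg]; ring
  have hgwi : MeasureTheory.Integrable (fun z => g z * w z) := by
    rw [hgw]; exact (hwi.const_mul σ).sub hw2i
  have hgwc : Continuous (fun z => g z * w z) := by fun_prop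
  have hgw0 : ∫ z, g z * w z = 0 := by
    rw [hgw, MeasureTheory.integral_sub (hwi.const_mul σ) hw2i,
      MeasureTheory.integral_const_mul,
      MeasureTheory.integral_of_hasDerivAt_of_tendsto hθd hwi lb lt, hσ]
    ring
  have hgb : ∀ z, |g z| ≤ |σ| + B := fun z => (abs_sub _ _).trans (by linarith [hB z])
  set C : ℝ := ∫ z in Set.Iic (0:ℝ), g z * w z with hC
  set G : ℝ → ℝ := fun z => C + ∫ s in (0:ℝ)..z, g s * w s with hG
  have hGd : ∀ z, HasDerivAt G (g z * w z) z := fun z => (aux_primitive hgwc 0 z).const_add C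
  have hGc : Continuous G := continuous_iff_continuousAt.2 fun z => (hGd z).continuousAt
  have lG : Tendsto G atTop (nhds 0) := by
    have h1 := MeasureTheory.intervalIntegral_tendsto_integral_Ioi (0:ℝ)
      hgwi.integrableOn (tendsto_id (α := ℝ) (x := atTop))
    have h2 := h1.const_add C
    rwa [hC, intervalIntegral.integral_Iic_add_Ioi hgwi.integrableOn hgwi.integrableOn, hgw0] at h2
  have lGb : Tendsto G atBot (nhds 0) := by
    have h1 := MeasureTheory.intervalIntegral_tendsto_integral_Iic (0:ℝ)
      hgwi.integrableOn (tendsto_id (α := ℝ) (x := atBot))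
    have h2 := h1.const_sub C
    rw [← hC, sub_self] at h2
    refine h2.congr (fun z => ?_)
    simp only [hG, id]
    rw [intervalIntegral.integral_symm z 0]
    ring
  have hvc : Continuous (fun z => G z / w z ^ 2) :=
    hGc.div (hwc.pow 2) (fun z => pow_ne_zero 2 (hw z).ne')
  set v : ℝ → ℝ := fun z => ∫ s in (0:ℝ)..z, G s / w s ^ 2 with hv
  have hvd : ∀ z, HasDerivAt v (G z / w z ^ 2) z := aux_primitive hvc 0
  have hvcont : Continuous v := continuous_iff_continuousAt.2 fun z => (hvd z).continuousAt
  obtain ⟨M1, hM1⟩ := aux_half hw hwd hw1d hp1 lq lw lw1 hgb hGd lG hvd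
  have hneg : ∀ {h : ℝ → ℝ} {h' : ℝ → ℝ}, (∀ z, HasDerivAt h (h' z) z) →
      ∀ z, HasDerivAt (fun y => h (-y)) (-h' (-z)) z := by
    intro h h' hd z
    have := (hd (-z)).comp z (hasDerivAt_neg z)
    exact this.congr_deriv (by ring)
  obtain ⟨M2, hM2⟩ := aux_half (w := fun z => w (-z)) (w1 := fun z => -w1 (-z))
    (q := fun z => q (-z)) (g := fun z => g (-z)) (G := fun z => -G (-z)) (v := fun z => v (-z))
    (K := |σ| + B) (a := deriv f (-1))
    (fun z => hw (-z)) (hneg hwd)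
    (fun z => (hneg hw1d z).neg.congr_deriv (by ring)) hpm1 (lqb.comp tendsto_neg_atTop_atBot)
    (lwb.comp tendsto_neg_atTop_atBot)
    (by simpa using (lw1b.comp tendsto_neg_atTop_atBot).neg)
    (fun z => hgb (-z)) (fun z => (hneg hGd z).neg.congr_deriv (by ring))
    (by simpa using (lGb.comp tendsto_neg_atTop_atBot).neg)
    (fun z => (hneg hvd z).congr_deriv (by ring))
  have hud : ∀ z, HasDerivAt (fun z => w z * v z) (w1 z * v z + G z / w z) z := by
    intro z
    have := (hwd z).mul (hvd z)
    refine this.congr_deriv ?_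
    have := (hw z).ne'
    field_simp
  have hud2 : ∀ z, HasDerivAt (fun z => w1 z * v z + G z / w z) (q z * (w z * v z) + g z) z := by
    intro z
    have := ((hw1d z).mul (hvd z)).add ((hGd z).div (hwd z) (hw z).ne')
    refine this.congr_deriv ?_
    have := (hw z).ne'
    field_simp
    ring
  have du : deriv (fun z => w z * v z) = fun z => w1 z * v z + G z / w z :=
    funext fun z => (hud z).deriv
  have ddu : deriv (deriv (fun z => w z * v z)) = fun z => q z * (w z * v z) + g z := by
    rw [du]; exact funext fun z => (hud2 z).deriv
  refine ⟨fun z => w z * v z, ⟨?_, ?_, ?_, ?_⟩, ?_⟩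
  · rw [show (2 : WithTop ℕ∞) = 1 + 1 by norm_num, contDiff_succ_iff_deriv]
    refine ⟨fun z => (hud z).differentiableAt, by simp, ?_⟩
    rw [contDiff_one_iff_deriv]
    refine ⟨?_, ?_⟩
    · rw [du]; exact fun z => (hud2 z).differentiableAt
    · rw [ddu]; fun_prop
  · refine ⟨max M1 M2, fun z => ?_⟩
    rcases le_total 0 z with h | h
    · exact le_max_of_le_left (hM1 z h)
    · have := hM2 (-z) (by linarith)
      simp only [neg_neg] at this
      exact le_max_of_le_right this
  · intro z
    rw [ddu]
    simp only [hq, hg]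
    ring
  · simp [hv]
  · rintro y ⟨hy2, ⟨My, hMy⟩, hyode, hy0⟩
    have hyd : ∀ z, HasDerivAt y (deriv y z) z :=
      fun z => (hy2.differentiable (by norm_num) z).hasDerivAt
    have hyc1 : ContDiff ℝ 1 (deriv y) := by
      have : ContDiff ℝ (1 + 1) y := by simpa [one_add_one_eq_two] using hy2
      exact (contDiff_succ_iff_deriv.1 this).2.2
    have hyd2 : ∀ z, HasDerivAt (deriv y) (q z * y z + g z) z := by
      intro z
      have h := (hyc1.differentiable (by norm_num) z).hasDerivAt
      rwa [show deriv (deriv y) z = q z * y z + g z by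
        have := hyode z
        simp only [hq, hg]
        linarith] at h
    -- difference
    obtain ⟨d, hdd⟩ : ∃ d : ℝ → ℝ, d = fun z => y z - w z * v z := ⟨_, rfl⟩
    obtain ⟨d1, hd1⟩ : ∃ d1 : ℝ → ℝ, d1 = fun z => deriv y z - (w1 z * v z + G z / w z) := ⟨_, rfl⟩
    have hdD : ∀ z, HasDerivAt d (d1 z) z := by
      intro z; rw [hdd, hd1]; exact (hyd z).sub (hud z)
    have hd1D : ∀ z, HasDerivAt d1 (q z * d z) z := by
      intro z
      have := (hyd2 z).sub (hud2 z)
      rw [hdd, hd1]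
      refine this.congr_deriv ?_
      ring
    have hd0 : d 0 = 0 := by simp [hdd, hy0, hv]
    have hdb : ∀ z, 0 ≤ z → |d z| ≤ My + M1 := by
      intro z hz
      rw [hdd]
      exact (abs_sub _ _).trans (add_le_add (hMy z) (hM1 z hz))
    have hWr : ∀ z, d1 z * w z - d z * w1 z = d1 0 * w 0 - d 0 * w1 0 := by
      intro z
      refine aux_const (h := fun z => d1 z * w z - d z * w1 z) (fun t => ?_) z 0
      have := ((hd1D t).mul (hwd t)).sub ((hdD t).mul (hw1d t))
      refine this.congr_deriv ?_
      ring
    have hk : d1 0 * w 0 - d 0 * w1 0 = 0 := by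
      obtain ⟨x, hx, hx'⟩ := aux_seq hdD
      have hb1 : ∀ n, |d1 (x n)| ≤ 2 * (My + M1) := by
        intro n
        rw [hx' n]
        refine (abs_sub _ _).trans ?_
        linarith [hdb n (by positivity), hdb (n + 1) (by positivity)]
      have t1 : Tendsto (fun n => d1 (x n) * w (x n)) atTop (nhds 0) := by
        refine squeeze_zero_norm (a := fun n => 2 * (My + M1) * |w (x n)|) ?_ ?_
        · intro n
          rw [norm_mul]
          exact mul_le_mul_of_nonneg_right (hb1 n) (abs_nonneg _)
        · simpa using ((lw.comp hx).abs).const_mul (2 * (My + M1))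
      have t2 : Tendsto (fun n => d (x n) * w1 (x n)) atTop (nhds 0) := by
        refine squeeze_zero_norm' (a := fun n => (My + M1) * |w1 (x n)|) ?_ ?_
        · filter_upwards [hx.eventually_ge_atTop 0] with n hn
          rw [norm_mul]
          exact mul_le_mul_of_nonneg_right (hdb _ hn) (abs_nonneg _)
        · simpa using ((lw1.comp hx).abs).const_mul (My + M1)
      have t3 := t1.sub t2
      simp only [hWr] at t3
      have := tendsto_nhds_unique t3 tendsto_const_nhds
      rw [← this]; norm_num
    have hquot : ∀ z, d z / w z = d 0 / w 0 := by
      intro z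
      refine aux_const (h := fun z => d z / w z) (fun t => ?_) z 0
      have := (hdD t).div (hwd t) (hw t).ne'
      refine this.congr_deriv ?_
      have h1 := hWr t
      rw [hk] at h1
      rw [h1, zero_div]
    funext z
    have h1 := hquot z
    rw [hd0, zero_div, div_eq_zero_iff] at h1
    have h2 : d z = 0 := h1.resolve_right (hw z).ne'
    rw [hdd] at h2
    simp only at h2
    linarith
end

section
/- Let f : ℝ → ℝ satisfy the double-well conditions, let θ₀ be the unique solution of the standing-wave problem, and set σ := ½ ∫_ℝ (θ₀'(z))² dz. Let θ₁ ∈ C²(ℝ) be any function such that θ₁ and θ₁' are bounded and θ₁''(z) − f'(θ₀(z)) θ₁(z) = σ − θ₀'(z) for all z ∈ ℝ. Then ∫_ℝ f''(θ₀(z)) (θ₀'(z))² θ₁(z) dz = 0. -/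
open Filter

lemma barbalat_aux (w p q : ℝ → ℝ) (hw : ∀ z, HasDerivAt w (p z) z)
    (hp : ∀ z, HasDerivAt p (q z) z) :
    ∃ η : ℝ → ℝ, (∀ z, z ≤ η z ∧ η z ≤ z + 1) ∧
      ∀ z, |p z| ≤ |w (z + 1) - w z| + |q (η z)| := by
  have key : ∀ z : ℝ, ∃ η : ℝ, (z ≤ η ∧ η ≤ z + 1) ∧
      |p z| ≤ |w (z + 1) - w z| + |q η| := by
    intro z
    obtain ⟨ξ, hξ, h1⟩ := exists_hasDerivAt_eq_slope w p (show z < z + 1 by linarith)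
      (fun x _ => (hw x).continuousAt.continuousWithinAt) (fun x _ => hw x)
    obtain ⟨η, hη, h2⟩ := exists_hasDerivAt_eq_slope p q hξ.1
      (fun x _ => (hp x).continuousAt.continuousWithinAt) (fun x _ => hp x)
    refine ⟨η, ⟨hη.1.le, (hη.2.trans hξ.2).le⟩, ?_⟩
    have h0 : 0 < ξ - z := sub_pos.2 hξ.1
    have h3 : ξ - z ≤ 1 := by linarith [hξ.2]
    rw [eq_div_iff h0.ne'] at h2
    have h4 : p z = (w (z + 1) - w z) - q η * (ξ - z) := by
      rw [h2, h1]; simp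
    rw [h4]
    refine (abs_sub _ _).trans ?_
    rw [abs_mul, abs_of_pos h0]
    have := mul_le_mul_of_nonneg_left h3 (abs_nonneg (q η))
    linarith
  choose η h1 h2 using key
  exact ⟨η, h1, h2⟩

lemma barbalat_lim (w p q η : ℝ → ℝ) (l : Filter ℝ) (a : ℝ)
    (h : ∀ z, |p z| ≤ |w (z + 1) - w z| + |q (η z)|)
    (h1 : Tendsto (fun z : ℝ => z + 1) l l) (hη : Tendsto η l l)
    (hw : Tendsto w l (nhds a)) (hq : Tendsto q l (nhds 0)) : Tendsto p l (nhds 0) := by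
  rw [tendsto_zero_iff_abs_tendsto_zero]
  refine squeeze_zero (fun z => abs_nonneg _) h ?_
  simpa using ((hw.comp h1).sub hw).abs.add (hq.comp hη).abs

/-- If `θ₁ ∈ C²(ℝ)` with `θ₁`, `θ₁'` bounded solves
`θ₁'' - f'(θ₀) θ₁ = σ - θ₀'` where `σ = ½ ∫_ℝ (θ₀')²`, then
`∫_ℝ f''(θ₀) (θ₀')² θ₁ = 0`. -/
theorem theta1_orthogonality (f θ₀ θ₁ : ℝ → ℝ)
    (hf : DoubleWell f) (hθ₀ : StandingWave f θ₀)
    (hθ₁ : ContDiff ℝ 2 θ₁)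
    (hθ₁bd : ∃ M : ℝ, ∀ z : ℝ, |θ₁ z| ≤ M)
    (hθ₁'bd : ∃ M : ℝ, ∀ z : ℝ, |deriv θ₁ z| ≤ M)
    (hode : ∀ z : ℝ, deriv (deriv θ₁) z - deriv f (θ₀ z) * θ₁ z =
      (1 / 2 * ∫ y : ℝ, (deriv θ₀ y) ^ 2) - deriv θ₀ z) :
    (∫ z : ℝ, deriv (deriv f) (θ₀ z) * (deriv θ₀ z) ^ 2 * θ₁ z) = 0 := by
  obtain ⟨hfs, hf1, hfm1, -⟩ := hf
  obtain ⟨hw2, hwode, -, hwt, hwb⟩ := hθ₀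
  obtain ⟨M, hM⟩ := hθ₁bd
  obtain ⟨M', hM'⟩ := hθ₁'bd
  generalize (1 / 2 * ∫ y : ℝ, (deriv θ₀ y) ^ 2) = σ at hode
  have hfi : ContDiff ℝ 2 f := contDiff_infty.1 hfs 2
  have hd : ∀ g : ℝ → ℝ, ContDiff ℝ 2 g → (∀ z, HasDerivAt g (deriv g z) z) ∧
      (∀ z, HasDerivAt (deriv g) (deriv (deriv g) z) z) := by
    intro g hg
    refine ⟨fun z => (hg.differentiable (by norm_num) z).hasDerivAt, fun z => ?_⟩
    have : ContDiff ℝ 1 (deriv g) := by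
      have h2 : ContDiff ℝ (1 + 1) g := by simpa [one_add_one_eq_two] using hg
      exact (contDiff_succ_iff_deriv.1 h2).2.2
    exact (this.differentiable (by norm_num) z).hasDerivAt
  obtain ⟨df, ddf⟩ := hd f hfi
  obtain ⟨dw, ddw⟩ := hd θ₀ hw2
  obtain ⟨dt, ddt⟩ := hd θ₁ hθ₁
  have hq : ∀ z, deriv (deriv θ₀) z = f (θ₀ z) := fun z => by linarith [hwode z]
  have dp : ∀ z, HasDerivAt (deriv θ₀) (f (θ₀ z)) z := fun z => hq z ▸ ddw z
  obtain ⟨η, hη, hb⟩ := barbalat_aux θ₀ (deriv θ₀) (fun z => f (θ₀ z)) dw dp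
  have fc : ∀ x, ContinuousAt f x := fun x => (df x).continuousAt
  have fdc : ∀ x, ContinuousAt (deriv f) x := fun x => (ddf x).continuousAt
  have qt : Tendsto (fun z => f (θ₀ z)) atTop (nhds 0) := by
    simpa [hf1, Function.comp_def] using (fc 1).tendsto.comp hwt
  have qb : Tendsto (fun z => f (θ₀ z)) atBot (nhds 0) := by
    simpa [hfm1, Function.comp_def] using (fc (-1)).tendsto.comp hwb
  have pt : Tendsto (deriv θ₀) atTop (nhds 0) :=
    barbalat_lim _ _ _ η _ _ hb (tendsto_atTop_add_const_right _ _ tendsto_id)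
      (tendsto_atTop_mono (fun z => (hη z).1) tendsto_id) hwt qt
  have h1b : Tendsto (fun z : ℝ => z + 1) atBot atBot :=
    tendsto_atBot_add_const_right _ _ tendsto_id
  have pb : Tendsto (deriv θ₀) atBot (nhds 0) :=
    barbalat_lim _ _ _ η _ _ hb h1b
      (tendsto_atBot_mono (fun z => (hη z).2) h1b) hwb qb
  have bdd : ∀ (l : Filter ℝ) (g b : ℝ → ℝ) (C : ℝ), (∀ z, |b z| ≤ C) →
      Tendsto g l (nhds 0) → Tendsto (fun z => g z * b z) l (nhds 0) := by
    intro l g b C hC hg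
    refine squeeze_zero_norm (a := fun z => |g z| * C) (fun z => ?_) ?_
    · rw [Real.norm_eq_abs, abs_mul]
      exact mul_le_mul_of_nonneg_left (hC z) (abs_nonneg _)
    · simpa using hg.abs.mul_const C
  have lim : ∀ (l : Filter ℝ) (a : ℝ), Tendsto θ₀ l (nhds a) →
      Tendsto (fun z => f (θ₀ z)) l (nhds 0) → Tendsto (deriv θ₀) l (nhds 0) →
      Tendsto (fun z => deriv f (θ₀ z) * deriv θ₀ z * θ₁ z - f (θ₀ z) * deriv θ₁ z
        + σ * deriv θ₀ z - (deriv θ₀ z) ^ 2 / 2) l (nhds 0) := by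
    intro l a hw hq hp
    have e1 : Tendsto (fun z => deriv f (θ₀ z) * deriv θ₀ z) l (nhds 0) := by
      simpa using ((fdc a).tendsto.comp hw).mul hp
    have e2 := bdd l _ θ₁ M hM e1
    have e3 := bdd l _ (deriv θ₁) M' hM' hq
    simpa using ((e2.sub e3).add (hp.const_mul σ)).sub ((hp.pow 2).div_const 2)
  by_cases hi : MeasureTheory.Integrable
      (fun z : ℝ => deriv (deriv f) (θ₀ z) * (deriv θ₀ z) ^ 2 * θ₁ z)
  · have := MeasureTheory.integral_of_hasDerivAt_of_tendsto (fun z => ?_) hi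
      (lim _ _ hwb qb pb) (lim _ _ hwt qt pt)
    · simpa using this
    · have a1 : HasDerivAt (fun z => deriv f (θ₀ z)) (deriv (deriv f) (θ₀ z) * deriv θ₀ z) z :=
        (ddf (θ₀ z)).comp z (dw z)
      have a2 : HasDerivAt (fun z => f (θ₀ z)) (deriv f (θ₀ z) * deriv θ₀ z) z :=
        (df (θ₀ z)).comp z (dw z)
      have a3 := ((((a1.mul (dp z)).mul (dt z)).sub (a2.mul (ddt z))).add
        ((dp z).const_mul σ)).sub (((dp z).pow 2).div_const 2)
      refine a3.congr_deriv ?_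
      have e : deriv (deriv θ₁) z = deriv f (θ₀ z) * θ₁ z + (σ - deriv θ₀ z) := by
        linarith [hode z]
      simp only [Pi.mul_apply]
      rw [e]
      push_cast
      ring
  · exact MeasureTheory.integral_undef hi
end

section
/- Let f : ℝ → ℝ satisfy the double-well conditions, let θ₀ be the unique solution of the standing-wave problem, fix α with 0 < α < min{√(f'(−1)), √(f'(1))}, and let A : ℝ → ℝ be continuous with |A(z)| ≤ C e^{−α|z|} for all z and some C > 0. Then the problem c ∈ C²(ℝ) bounded, c''(z) − f'(θ₀(z)) c(z) = A(z) for all z ∈ ℝ, admits a solution if and only if ∫_ℝ A(z) θ₀'(z) dz = 0; and in that case there is exactly one bounded solution with c(0) = 0. -/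
open Filter

/-- A continuous function with limits at both ends is bounded. -/
lemma aux_bdd {g : ℝ → ℝ} (hg : Continuous g) {a b : ℝ} (ha : Tendsto g atTop (nhds a))
    (hb : Tendsto g atBot (nhds b)) : ∃ M, ∀ z, |g z| ≤ M := by
  have h1 : ∀ᶠ z in atTop, |g z| < |a| + 1 := ha.abs.eventually_lt_const (by linarith)
  have h2 : ∀ᶠ z in atBot, |g z| < |b| + 1 := hb.abs.eventually_lt_const (by linarith)
  obtain ⟨T, hT⟩ := eventually_atTop.1 h1
  obtain ⟨S, hS⟩ := eventually_atBot.1 h2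
  obtain ⟨K, hK⟩ := (isCompact_Icc (a := S) (b := T)).exists_bound_of_continuousOn hg.continuousOn
  refine ⟨max K (max (|a| + 1) (|b| + 1)), fun z => ?_⟩
  rcases le_total T z with h | h
  · exact (hT z h).le.trans ((le_max_left _ _).trans (le_max_right _ _))
  rcases le_total z S with h' | h'
  · exact (hS z h').le.trans ((le_max_right _ _).trans (le_max_right _ _))
  · exact (hK z ⟨h', h⟩).trans (le_max_left _ _)

/-- Landau type bound for the first derivative. -/
lemma aux_landau {c c1 c2 : ℝ → ℝ} (h1 : ∀ z, HasDerivAt c (c1 z) z)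
    (h2 : ∀ z, HasDerivAt c1 (c2 z) z) {M N : ℝ} (hM : ∀ z, |c z| ≤ M) (hN : ∀ z, |c2 z| ≤ N) :
    ∃ K, ∀ z, |c1 z| ≤ K := by
  refine ⟨2 * M + N, fun z => ?_⟩
  obtain ⟨x, hx, hxe⟩ := exists_hasDerivAt_eq_slope c c1 (show z < z + 1 by linarith)
    (fun y _ => (h1 y).continuousAt.continuousWithinAt) (fun y _ => h1 y)
  obtain ⟨y, hy, hye⟩ := exists_hasDerivAt_eq_slope c1 c2 hx.1
    (fun y _ => (h2 y).continuousAt.continuousWithinAt) (fun y _ => h2 y)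
  have e1 : c1 x = c (z + 1) - c z := by rw [hxe]; simp
  have hpos : 0 < x - z := by linarith [hx.1]
  have e2 : c1 z = c1 x - c2 y * (x - z) := by rw [hye]; field_simp; ring
  have b1 := abs_le.1 (hM z)
  have b2 := abs_le.1 (hM (z + 1))
  have b3 : |c2 y * (x - z)| ≤ N := by
    rw [abs_mul, abs_of_pos hpos]
    have := abs_nonneg (c2 y)
    have := hN y
    nlinarith [hx.2]
  have b4 := abs_le.1 b3
  rw [e2, e1, abs_le]
  constructor <;> linarith

/-- Energy constant of a converging trajectory vanishes. -/
lemma aux_energy {w p : ℝ → ℝ} (h1 : ∀ z, HasDerivAt w (p z) z) {a E : ℝ}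
    (hw : Tendsto w atTop (nhds a)) (hp : Tendsto (fun z => p z ^ 2) atTop (nhds E)) : E = 0 := by
  have hex : ∀ n : ℕ, ∃ x : ℝ, (n : ℝ) < x ∧ p x = w (n + 1) - w n := by
    intro n
    obtain ⟨x, hx, hxe⟩ := exists_hasDerivAt_eq_slope w p (show (n : ℝ) < n + 1 by linarith)
      (fun y _ => (h1 y).continuousAt.continuousWithinAt) (fun y _ => h1 y)
    exact ⟨x, hx.1, by rw [hxe]; simp⟩
  choose x hx hxe using hex
  have hn : Tendsto (fun n : ℕ => (n : ℝ)) atTop atTop := tendsto_natCast_atTop_atTop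
  have hxt : Tendsto x atTop atTop := tendsto_atTop_mono (fun n => (hx n).le) hn
  have l1 := hp.comp hxt
  have l2 : Tendsto (fun n : ℕ => (w (n + 1) - w n) ^ 2) atTop (nhds ((a - a) ^ 2)) :=
    ((hw.comp (tendsto_atTop_add_const_right _ 1 hn)).sub (hw.comp hn)).pow 2
  have : (fun n : ℕ => (w (n + 1) - w n) ^ 2) = (fun z => p z ^ 2) ∘ x := by
    funext n; simp [hxe]
  rw [this] at l2
  simpa using tendsto_nhds_unique l1 l2

/-- Uniqueness for the linear second order equation with zero data. -/
lemma aux_unique {p p1 q : ℝ → ℝ} (h1 : ∀ z, HasDerivAt p (p1 z) z)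
    (h2 : ∀ z, HasDerivAt p1 (q z * p z) z) {Q : ℝ} (hQ : ∀ z, |q z| ≤ Q) {z₀ : ℝ}
    (h0 : p z₀ = 0) (h0' : p1 z₀ = 0) : ∀ z, p z = 0 := by
  have hQ0 : 0 ≤ Q := (abs_nonneg _).trans (hQ 0)
  have key : (fun z => (p z, p1 z)) = (fun _ => ((0 : ℝ), (0 : ℝ))) := by
    refine ODE_solution_unique_univ (v := fun t x => (x.2, q t * x.1)) (s := fun _ => Set.univ)
      (K := Real.toNNReal (Q + 1)) (t₀ := z₀) ?_ ?_ ?_ ?_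
    · intro t
      rw [lipschitzOnWith_univ]
      refine LipschitzWith.of_dist_le_mul fun x y => ?_
      simp only [Prod.dist_eq, Real.coe_toNNReal (Q + 1) (by linarith), Real.dist_eq]
      have m1 := le_max_left |x.1 - y.1| |x.2 - y.2|
      have m2 := le_max_right |x.1 - y.1| |x.2 - y.2|
      have a1 := abs_nonneg (x.1 - y.1)
      refine max_le ?_ ?_
      · nlinarith
      · rw [← mul_sub, abs_mul]
        have := mul_le_mul (hQ t) m1 a1 hQ0
        nlinarith
    · exact fun t => ⟨(h1 t).prodMk (h2 t), trivial⟩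
    · intro t
      refine ⟨?_, trivial⟩
      convert hasDerivAt_const t ((0 : ℝ), (0 : ℝ)) using 1
      simp
    · simp [h0, h0']
  intro z
  exact congrArg Prod.fst (congrFun key z)

/-- Quasi-monotonicity of `p` on the half line. -/
lemma aux_quasi {p p1 : ℝ → ℝ} (h1 : ∀ z, HasDerivAt p (p1 z) z) (hp : ∀ z, 0 < p z)
    (hev : ∀ᶠ z in atTop, p1 z ≤ 0) :
    ∃ K, 0 < K ∧ ∀ s t, 0 ≤ s → s ≤ t → p t ≤ K * p s := by
  obtain ⟨T0, hT0⟩ := eventually_atTop.1 hev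
  set T := max T0 0 with hT
  have hc : Continuous p := continuous_iff_continuousAt.2 fun z => (h1 z).continuousAt
  have hanti : AntitoneOn p (Set.Ici T) := by
    refine antitoneOn_of_deriv_nonpos (convex_Ici T) hc.continuousOn
      (fun z _ => (h1 z).differentiableAt.differentiableWithinAt) ?_
    intro z hz
    rw [interior_Ici] at hz
    rw [(h1 z).deriv]
    exact hT0 z ((le_max_left _ _).trans hz.le)
  have hne : (Set.Icc 0 T).Nonempty := ⟨0, by simp [hT]⟩
  obtain ⟨x, hx, hxm⟩ := isCompact_Icc.exists_isMinOn hne hc.continuousOn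
  obtain ⟨y, hy, hym⟩ := isCompact_Icc.exists_isMaxOn hne hc.continuousOn
  have hxy : p x ≤ p y := hym hx
  have hK : 1 ≤ p y / p x := by rw [le_div_iff₀ (hp x)]; linarith
  refine ⟨p y / p x, by linarith, fun s t hs hst => ?_⟩
  rcases le_total T s with h | h
  · have := hanti h (show T ≤ t by linarith) hst
    nlinarith [hp s]
  · have hs' : p x ≤ p s := hxm ⟨hs, h⟩
    have ht' : p t ≤ p y := by
      rcases le_total t T with h' | h'
      · exact hym ⟨by linarith, h'⟩
      · exact (hanti (le_refl T) h' h').trans (hym (⟨by simp [hT], le_refl T⟩ : T ∈ Set.Icc 0 T))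
    refine ht'.trans ?_
    calc p y = p y / p x * p x := by field_simp [(hp x).ne']
      _ ≤ p y / p x * p s := by gcongr

open MeasureTheory in
/-- Tail bound. -/
lemma aux_tail {p B : ℝ → ℝ} {K C α : ℝ} (hp : ∀ z, 0 < p z) (hα : 0 < α)
    (hK : 0 < K ∧ ∀ s t, 0 ≤ s → s ≤ t → p t ≤ K * p s)
    (hB : ∀ z, |B z| ≤ C * Real.exp (-α * |z|)) {s : ℝ} (hs : 0 ≤ s) :
    |∫ t in Set.Ioi s, B t * p t| ≤ K * C / α * p s * Real.exp (-α * s) := by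
  have hint : IntegrableOn (fun t => K * p s * C * Real.exp (-α * t)) (Set.Ioi s) :=
    (integrableOn_exp_mul_Ioi (by linarith) s).const_mul _
  have := norm_integral_le_of_norm_le (f := fun t => B t * p t) hint (by
    refine (ae_restrict_mem measurableSet_Ioi).mono fun t ht => ?_
    have ht' : s < t := ht
    have hb := hB t
    rw [abs_of_pos (by linarith : 0 < t)] at hb
    have hpp := hK.2 s t hs ht'.le
    rw [Real.norm_eq_abs, abs_mul, abs_of_pos (hp t)]
    calc |B t| * p t ≤ (C * Real.exp (-α * t)) * (K * p s) :=
          mul_le_mul hb hpp (hp t).le ((abs_nonneg _).trans hb)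
      _ = _ := by ring)
  rw [Real.norm_eq_abs, integral_const_mul, integral_exp_mul_Ioi (by linarith)] at this
  refine this.trans (le_of_eq ?_)
  field_simp

/-- Boundedness of the variation of constants formula on the half line. -/
lemma aux_half_s16 {p I : ℝ → ℝ} {K D α : ℝ} (hp : ∀ z, 0 < p z) (hα : 0 < α)
    (hK : 0 < K ∧ ∀ s t, 0 ≤ s → s ≤ t → p t ≤ K * p s)
    (hI : ∀ s, 0 ≤ s → |I s| ≤ D * p s * Real.exp (-α * s)) {z : ℝ} (hz : 0 ≤ z) :
    |p z * ∫ s in (0 : ℝ)..z, I s / p s ^ 2| ≤ K * D / α := by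
  have hD : 0 ≤ D := by
    have := (abs_nonneg _).trans (hI 0 le_rfl)
    simp only [mul_zero, Real.exp_zero, mul_one] at this
    exact nonneg_of_mul_nonneg_left this (hp 0)
  rw [← intervalIntegral.integral_const_mul]
  have h1 : ‖∫ s in (0 : ℝ)..z, p z * (I s / p s ^ 2)‖
      ≤ ∫ s in (0 : ℝ)..z, K * D * Real.exp (-α * s) := by
    refine intervalIntegral.norm_integral_le_of_norm_le hz ?_
      (Continuous.intervalIntegrable (by fun_prop) _ _)
    refine MeasureTheory.ae_of_all _ fun s hs => ?_
    have hps := hp s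
    have h2 := hI s hs.1.le
    have h3 := hK.2 s z hs.1.le hs.2
    rw [Real.norm_eq_abs, abs_mul, abs_div, abs_of_pos (hp z), abs_of_pos (pow_pos hps 2)]
    rw [← mul_div_assoc, div_le_iff₀ (pow_pos hps 2)]
    calc p z * |I s| ≤ (K * p s) * (D * p s * Real.exp (-α * s)) :=
          mul_le_mul h3 h2 (abs_nonneg _) (by have := hK.1; positivity)
      _ = _ := by ring
  rw [Real.norm_eq_abs] at h1
  refine h1.trans ?_
  have h4 : ∫ s in (0 : ℝ)..z, Real.exp (-α * s) = (1 - Real.exp (-α * z)) / α := by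
    have : ∀ s ∈ Set.uIcc 0 z, HasDerivAt (fun s => -Real.exp (-α * s) / α)
        (Real.exp (-α * s)) s := by
      intro s _
      have := (((hasDerivAt_id s).const_mul (-α)).exp.neg).div_const α
      refine HasDerivAt.congr_deriv this ?_
      simp only [id, mul_one]
      field_simp
    rw [intervalIntegral.integral_eq_sub_of_hasDerivAt this
      (Continuous.intervalIntegrable (by fun_prop) _ _)]
    simp; ring
  rw [intervalIntegral.integral_const_mul, h4, mul_div_assoc]
  have := Real.exp_pos (-α * z)
  have := hK.1
  rw [← mul_div_assoc, ← mul_div_assoc, div_le_div_iff_of_pos_right hα]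
  nlinarith [mul_nonneg this.le hD]

open MeasureTheory in
lemma aux_exp_integrable {α : ℝ} (hα : 0 < α) : Integrable (fun z : ℝ => Real.exp (-α * |z|)) := by
  rw [← integrableOn_univ, ← Set.Iic_union_Ioi (a := (0 : ℝ)), integrableOn_union]
  constructor
  · refine (integrableOn_exp_mul_Iic hα 0).congr_fun (fun z hz => ?_) measurableSet_Iic
    simp only; rw [abs_of_nonpos hz]; ring_nf
  · refine (integrableOn_exp_mul_Ioi (a := -α) (by linarith) 0).congr_fun (fun z hz => ?_)
      measurableSet_Ioi
    simp only; rw [abs_of_pos hz]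

lemma aux_cd2 {c c1 c2 : ℝ → ℝ} (h1 : ∀ z, HasDerivAt c (c1 z) z)
    (h2 : ∀ z, HasDerivAt c1 (c2 z) z) (h3 : Continuous c2) :
    ContDiff ℝ 2 c ∧ deriv (deriv c) = c2 := by
  have e1 : deriv c = c1 := funext fun z => (h1 z).deriv
  have e2 : deriv c1 = c2 := funext fun z => (h2 z).deriv
  refine ⟨?_, by rw [e1, e2]⟩
  rw [show (2 : WithTop ℕ∞) = 1 + 1 by norm_num, contDiff_succ_iff_deriv, e1]
  refine ⟨fun z => (h1 z).differentiableAt, by simp, ?_⟩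
  rw [contDiff_one_iff_deriv, e2]
  exact ⟨fun z => (h2 z).differentiableAt, h3⟩

lemma aux_cd2' {c : ℝ → ℝ} (h : ContDiff ℝ 2 c) :
    (∀ z, HasDerivAt c (deriv c z) z) ∧ (∀ z, HasDerivAt (deriv c) (deriv (deriv c) z) z) := by
  have h' := h
  rw [show (2 : WithTop ℕ∞) = 1 + 1 by norm_num, contDiff_succ_iff_deriv] at h'
  exact ⟨fun z => (h'.1 z).hasDerivAt,
    fun z => (h'.2.2.differentiable (by norm_num) z).hasDerivAt⟩

/-- Facts about the standing wave. -/
lemma aux_wave_s16 {f w : ℝ → ℝ} (hf : DoubleWell f) (hw : StandingWave f w) :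
    (∀ z, HasDerivAt (deriv w) (f (w z)) z) ∧
    (∀ z, HasDerivAt (fun z => f (w z)) (deriv f (w z) * deriv w z) z) ∧
    (∀ z, 0 < deriv w z) ∧
    Tendsto (deriv w) atTop (nhds 0) ∧ Tendsto (deriv w) atBot (nhds 0) ∧
    Tendsto (fun z => f (w z)) atTop (nhds 0) ∧ Tendsto (fun z => f (w z)) atBot (nhds 0) ∧
    Continuous (fun z => deriv f (w z)) ∧ (∃ Q, ∀ z, |deriv f (w z)| ≤ Q) ∧
    (∀ᶠ z in atTop, f (w z) ≤ 0) ∧ (∀ᶠ z in atBot, 0 ≤ f (w z)) := by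
  obtain ⟨hsm, hf1, hfm1, hd1, hdm1, hF⟩ := hf
  obtain ⟨hwc, hode, hw0, hwt, hwb⟩ := hw
  obtain ⟨W1, W2⟩ := aux_cd2' hwc
  have hfc : Continuous f := hsm.continuous
  have hfd := contDiff_infty_iff_deriv.1 hsm
  have hfdc : Continuous (deriv f) := hfd.2.continuous
  have hwcont : Continuous w := hwc.continuous
  have P1 : ∀ z, HasDerivAt (deriv w) (f (w z)) z := by
    intro z
    have := W2 z
    rwa [show deriv (deriv w) z = f (w z) by linarith [hode z]] at this
  have P2 : ∀ z, HasDerivAt (fun z => f (w z)) (deriv f (w z) * deriv w z) z := fun z =>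
    HasDerivAt.comp z (hfd.1 (w z)).hasDerivAt (W1 z)
  have hpc : Continuous (deriv w) := continuous_iff_continuousAt.2 fun z => (P1 z).continuousAt
  have hqt : Tendsto (fun z => deriv f (w z)) atTop (nhds (deriv f 1)) :=
    (hfdc.tendsto 1).comp hwt
  have hqb : Tendsto (fun z => deriv f (w z)) atBot (nhds (deriv f (-1))) :=
    (hfdc.tendsto (-1)).comp hwb
  have hqc : Continuous (fun z => deriv f (w z)) := hfdc.comp hwcont
  obtain ⟨Q, hQ⟩ := aux_bdd hqc hqt hqb
  -- the potential
  set F : ℝ → ℝ := fun u => ∫ s in (-1 : ℝ)..u, f s with hFdef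
  have hFd : ∀ u, HasDerivAt F (f u) u := fun u => (hfc.integral_hasStrictDerivAt (-1) u).hasDerivAt
  have hFc : Continuous F := continuous_iff_continuousAt.2 fun z => (hFd z).continuousAt
  have hFm1 : F (-1) = 0 := by simp [hFdef]
  have hF1 : F 1 = 0 := by
    have h0 := (hF 0 (by constructor <;> norm_num)).1
    have h2 := intervalIntegral.integral_add_adjacent_intervals
      (hfc.intervalIntegrable (μ := MeasureTheory.volume) (-1) 0) (hfc.intervalIntegrable 0 1)
    rw [h0, intervalIntegral.integral_symm 0 1] at h2
    simp only [hFdef]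
    linarith
  have hEd : ∀ z, HasDerivAt (fun z => deriv w z ^ 2 - 2 * F (w z)) 0 z := by
    intro z
    have := ((P1 z).pow 2).sub ((HasDerivAt.comp z (hFd (w z)) (W1 z)).const_mul 2)
    refine HasDerivAt.congr_deriv this ?_
    push_cast; ring
  have hEc : ∀ z, deriv w z ^ 2 = (deriv w 0 ^ 2 - 2 * F (w 0)) + 2 * F (w z) := by
    intro z
    have := is_const_of_deriv_eq_zero (fun z => (hEd z).differentiableAt)
      (fun z => (hEd z).deriv) z 0
    linarith
  have hFt : Tendsto (fun z => F (w z)) atTop (nhds 0) := by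
    have := (hFc.tendsto 1).comp hwt
    rwa [hF1] at this
  have hFb : Tendsto (fun z => F (w z)) atBot (nhds 0) := by
    have := (hFc.tendsto (-1)).comp hwb
    rwa [hFm1] at this
  have hE0 : deriv w 0 ^ 2 - 2 * F (w 0) = 0 := by
    refine aux_energy W1 hwt ?_
    have := (hFt.const_mul 2).const_add (deriv w 0 ^ 2 - 2 * F (w 0))
    simp only [mul_zero, add_zero] at this
    exact this.congr fun z => (hEc z).symm
  have hE : ∀ z, deriv w z ^ 2 = 2 * F (w z) := fun z => by rw [hEc z, hE0, zero_add]
  have habs : ∀ l : Filter ℝ, Tendsto (fun z => F (w z)) l (nhds 0) →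
      Tendsto (deriv w) l (nhds 0) := by
    intro l hl
    have h1 : Tendsto (fun z => deriv w z ^ 2) l (nhds 0) := by
      have := hl.const_mul 2
      rw [mul_zero] at this
      exact this.congr fun z => (hE z).symm
    have h2 := h1.sqrt
    simp only [Real.sqrt_sq_eq_abs, Real.sqrt_zero] at h2
    exact (tendsto_zero_iff_abs_tendsto_zero _).2 h2
  -- `w` never hits a zero of both `F` and `f`
  have hexpos : ∃ z, 0 < deriv w z := by
    obtain ⟨T, hT⟩ := eventually_atTop.1 (hwt.eventually_const_lt (show (0 : ℝ) < 1 by norm_num))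
    have hTp : (0 : ℝ) < max T 1 := lt_of_lt_of_le one_pos (le_max_right _ _)
    obtain ⟨x, hx, hxe⟩ := exists_hasDerivAt_eq_slope w (deriv w) hTp
      hwcont.continuousOn (fun y _ => W1 y)
    refine ⟨x, ?_⟩
    rw [hxe, hw0]
    have := hT _ (le_max_left T 1)
    apply div_pos <;> linarith
  have hno : ∀ u, F u = 0 → f u = 0 → ∀ z, w z ≠ u := by
    intro u hu hu' z hz
    obtain ⟨y, hy⟩ := hexpos
    have h0 : deriv w z = 0 := by
      have := hE z
      rw [hz, hu, mul_zero] at this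
      exact pow_eq_zero_iff (two_ne_zero) |>.1 this
    have := aux_unique P1 P2 hQ h0 (by rw [hz, hu']) y
    linarith
  have hlt : ∀ z, w z < 1 := by
    intro z
    by_contra! h
    obtain ⟨y, hy⟩ := mem_range_of_exists_le_of_exists_ge hwcont ⟨0, by rw [hw0]; norm_num⟩ ⟨z, h⟩
    exact hno 1 hF1 hf1 y hy
  have hgt : ∀ z, -1 < w z := by
    intro z
    by_contra! h
    obtain ⟨y, hy⟩ := mem_range_of_exists_le_of_exists_ge hwcont ⟨z, h⟩ ⟨0, by rw [hw0]; norm_num⟩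
    exact hno (-1) hFm1 hfm1 y hy
  have hpos : ∀ z, 0 < deriv w z := by
    intro z
    by_contra! h
    obtain ⟨y, hy⟩ := hexpos
    obtain ⟨x, hx⟩ := mem_range_of_exists_le_of_exists_ge hpc ⟨z, h⟩ ⟨y, hy.le⟩
    have h1 := hE x
    have h2 := (hF (w x) ⟨hgt x, hlt x⟩).2
    rw [hx] at h1
    have h3 : 0 < F (w x) := h2
    linarith
  have hft : Tendsto (fun z => f (w z)) atTop (nhds 0) := by
    have := (hfc.tendsto 1).comp hwt
    rwa [hf1] at this
  have hfb : Tendsto (fun z => f (w z)) atBot (nhds 0) := by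
    have := (hfc.tendsto (-1)).comp hwb
    rwa [hfm1] at this
  refine ⟨P1, P2, hpos, habs _ hFt, habs _ hFb, hft, hfb, hqc, ⟨Q, hQ⟩, ?_, ?_⟩
  · have hs := hasDerivAt_iff_tendsto_slope.1 (hfd.1 1).hasDerivAt
    have hw' : Tendsto w atTop (nhdsWithin 1 {1}ᶜ) :=
      tendsto_nhdsWithin_iff.2 ⟨hwt, Eventually.of_forall fun z => (hlt z).ne⟩
    filter_upwards [(hs.comp hw').eventually_const_lt hd1] with z hz
    simp only [Function.comp, slope_def_field, hf1, sub_zero] at hz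
    have := hlt z
    by_contra! h
    have := div_neg_of_pos_of_neg h (show w z - 1 < 0 by linarith)
    linarith
  · have hs := hasDerivAt_iff_tendsto_slope.1 (hfd.1 (-1)).hasDerivAt
    have hw' : Tendsto w atBot (nhdsWithin (-1) {-1}ᶜ) :=
      tendsto_nhdsWithin_iff.2 ⟨hwb, Eventually.of_forall fun z => (hgt z).ne'⟩
    filter_upwards [(hs.comp hw').eventually_const_lt hdm1] with z hz
    simp only [Function.comp, slope_def_field, hfm1, sub_zero] at hz
    have := hgt z
    by_contra! h
    have := div_neg_of_neg_of_pos h (show 0 < w z - (-1) by linarith)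
    linarith

/-- The Wronskian with a bounded solution tends to zero at both ends. -/
lemma aux_wronskian {p p1 q A c c1 c2 : ℝ → ℝ} (P1 : ∀ z, HasDerivAt p (p1 z) z)
    (P2 : ∀ z, HasDerivAt p1 (q z * p z) z) {Q N : ℝ} (hQ : ∀ z, |q z| ≤ Q)
    (hN : ∀ z, |A z| ≤ N)
    (h1 : ∀ z, HasDerivAt c (c1 z) z) (h2 : ∀ z, HasDerivAt c1 (c2 z) z)
    (hc : ∀ z, c2 z - q z * c z = A z) {M : ℝ} (hM : ∀ z, |c z| ≤ M) :
    (∀ z, HasDerivAt (fun z => c1 z * p z - c z * p1 z) (A z * p z) z) ∧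
    ∀ l : Filter ℝ, Tendsto p l (nhds 0) → Tendsto p1 l (nhds 0) →
      Tendsto (fun z => c1 z * p z - c z * p1 z) l (nhds 0) := by
  have hQ0 : 0 ≤ Q := (abs_nonneg _).trans (hQ 0)
  obtain ⟨K, hK⟩ := aux_landau h1 h2 hM (N := Q * M + N) (by
    intro z
    have e : c2 z = q z * c z + A z := by linarith [hc z]
    rw [e]
    refine (abs_add_le _ _).trans (add_le_add ?_ (hN z))
    rw [abs_mul]
    exact mul_le_mul (hQ z) (hM z) (abs_nonneg _) hQ0)
  constructor
  · intro z
    have := ((h2 z).mul (P1 z)).sub ((h1 z).mul (P2 z))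
    refine HasDerivAt.congr_deriv this ?_
    rw [← hc z]; ring
  · intro l hp hp1
    have t1 : Tendsto (fun z => c1 z * p z) l (nhds 0) :=
      bdd_le_mul_tendsto_zero' K (Eventually.of_forall hK) hp
    have t2 : Tendsto (fun z => c z * p1 z) l (nhds 0) :=
      bdd_le_mul_tendsto_zero' M (Eventually.of_forall hM) hp1
    simpa using t1.sub t2

open MeasureTheory in
/-- Existence of a bounded solution by variation of constants. -/
lemma aux_exist {p p1 q A : ℝ → ℝ} (P1 : ∀ z, HasDerivAt p (p1 z) z)
    (P2 : ∀ z, HasDerivAt p1 (q z * p z) z) (hp : ∀ z, 0 < p z) (hq : Continuous q)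
    (hA : Continuous A) {C α : ℝ} (hα : 0 < α) (hAd : ∀ z, |A z| ≤ C * Real.exp (-α * |z|))
    (ht : ∀ᶠ z in atTop, p1 z ≤ 0) (hb : ∀ᶠ z in atBot, 0 ≤ p1 z)
    (hint : Integrable (fun z => A z * p z)) (h0 : ∫ z, A z * p z = 0) :
    ∃ c : ℝ → ℝ, ContDiff ℝ 2 c ∧ (∃ M : ℝ, ∀ z : ℝ, |c z| ≤ M) ∧
        (∀ z : ℝ, deriv (deriv c) z - q z * c z = A z) ∧ c 0 = 0 := by
  have hpc : Continuous p := continuous_iff_continuousAt.2 fun z => (P1 z).continuousAt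
  set I : ℝ → ℝ := fun s => ∫ t in Set.Iic s, A t * p t with hI
  have hId : ∀ s, HasDerivAt I (A s * p s) s := by
    intro s
    have e : I = fun s => I 0 + ∫ t in (0 : ℝ)..s, A t * p t := by
      funext s
      have := intervalIntegral.integral_Iic_sub_Iic (a := 0) (b := s)
        hint.integrableOn hint.integrableOn
      simp only [hI]
      linarith
    rw [e]
    exact (((hA.mul hpc).integral_hasStrictDerivAt 0 s).hasDerivAt).const_add _
  have hIc : Continuous I := continuous_iff_continuousAt.2 fun z => (hId z).continuousAt
  have hI' : ∀ s, I s = -∫ t in Set.Ioi s, A t * p t := by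
    intro s
    have := intervalIntegral.integral_Iic_add_Ioi (b := s) hint.integrableOn hint.integrableOn
    rw [h0] at this
    simp only [hI]
    linarith
  have P1n : ∀ z, HasDerivAt (fun z => p (-z)) (-p1 (-z)) z := by
    intro z
    have := HasDerivAt.comp z (P1 (-z)) (hasDerivAt_neg z)
    refine HasDerivAt.congr_deriv this ?_
    ring
  obtain ⟨K, hK⟩ := aux_quasi P1 hp ht
  obtain ⟨L, hL⟩ := aux_quasi P1n (fun z => hp (-z)) (by
    filter_upwards [tendsto_neg_atTop_atBot.eventually hb] with z hz
    linarith)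
  have hIcont : Continuous (fun s => I s / p s ^ 2) :=
    hIc.div (hpc.pow 2) fun z => (pow_pos (hp z) 2).ne'
  set v : ℝ → ℝ := fun z => ∫ s in (0 : ℝ)..z, I s / p s ^ 2 with hv
  have hvd : ∀ z, HasDerivAt v (I z / p z ^ 2) z := fun z =>
    (hIcont.integral_hasStrictDerivAt 0 z).hasDerivAt
  have hvc : Continuous v := continuous_iff_continuousAt.2 fun z => (hvd z).continuousAt
  have C1 : ∀ z, HasDerivAt (fun z => p z * v z) (p1 z * v z + I z / p z) z := by
    intro z
    have := (P1 z).mul (hvd z)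
    refine HasDerivAt.congr_deriv this ?_
    have := (hp z).ne'
    field_simp
  have C2 : ∀ z, HasDerivAt (fun z => p1 z * v z + I z / p z) (q z * (p z * v z) + A z) z := by
    intro z
    have := ((P2 z).mul (hvd z)).add ((hId z).div (P1 z) (hp z).ne')
    refine HasDerivAt.congr_deriv this ?_
    have := (hp z).ne'
    field_simp
    ring
  obtain ⟨hcd, hdd⟩ := aux_cd2 C1 C2 (by fun_prop)
  refine ⟨fun z => p z * v z, hcd, ?_, ?_, by simp [hv]⟩
  · refine ⟨max (K * (K * C / α) / α) (L * (L * C / α) / α), fun z => ?_⟩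
    rcases le_total 0 z with hz | hz
    · refine le_trans ?_ (le_max_left _ _)
      refine aux_half_s16 hp hα hK (fun s hs => ?_) hz
      rw [hI' s, abs_neg]
      exact aux_tail hp hα hK hAd hs
    · refine le_trans ?_ (le_max_right _ _)
      have := aux_half_s16 (p := fun z => p (-z)) (I := fun s => I (-s)) (D := L * C / α)
        (fun z => hp (-z)) hα hL (fun s hs => ?_) (z := -z) (by linarith)
      · have e : ∫ s in (0 : ℝ)..(-z), I (-s) / p (-s) ^ 2 = - v z := by
          rw [intervalIntegral.integral_comp_neg (fun s => I s / p s ^ 2), neg_neg, neg_zero,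
            intervalIntegral.integral_symm]
        rwa [e, neg_neg, mul_neg, abs_neg] at this
      · have := aux_tail (p := fun z => p (-z)) (B := fun z => A (-z)) (C := C)
          (fun z => hp (-z)) hα hL (fun z => by simpa using hAd (-z)) hs
        rwa [integral_comp_neg_Ioi s (fun t => A t * p t)] at this
  · intro z
    rw [hdd]; ring

/-- Solvability of the linearized equation `c'' - f'(θ₀) c = A` on `ℝ` with
bounded `c`: a bounded solution exists iff `∫_ℝ A θ₀' = 0`, and in this case
there is exactly one bounded solution with `c(0) = 0`. -/
theorem linearized_ode_solvability (f θ₀ : ℝ → ℝ)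
    (hf : DoubleWell f) (hθ₀ : StandingWave f θ₀)
    (α : ℝ) (hα : 0 < α)
    (hα' : α < min (Real.sqrt (deriv f (-1))) (Real.sqrt (deriv f 1)))
    (A : ℝ → ℝ) (hAc : Continuous A) (C : ℝ) (hC : 0 < C)
    (hAd : ∀ z : ℝ, |A z| ≤ C * Real.exp (-α * |z|)) :
    ((∃ c : ℝ → ℝ, ContDiff ℝ 2 c ∧ (∃ M : ℝ, ∀ z : ℝ, |c z| ≤ M) ∧
        ∀ z : ℝ, deriv (deriv c) z - deriv f (θ₀ z) * c z = A z) ↔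
      (∫ z : ℝ, A z * deriv θ₀ z) = 0) ∧
    ((∫ z : ℝ, A z * deriv θ₀ z) = 0 →
      ∃! c : ℝ → ℝ, ContDiff ℝ 2 c ∧ (∃ M : ℝ, ∀ z : ℝ, |c z| ≤ M) ∧
        (∀ z : ℝ, deriv (deriv c) z - deriv f (θ₀ z) * c z = A z) ∧ c 0 = 0) := by
  obtain ⟨P1, P2, hp, hpt, hpb, hft, hfb, hqc, ⟨Q, hQ⟩, ht, hb⟩ := aux_wave_s16 hf hθ₀
  have hpc : Continuous (deriv θ₀) := continuous_iff_continuousAt.2 fun z => (P1 z).continuousAt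
  obtain ⟨B, hB⟩ := aux_bdd hpc hpt hpb
  have hAN : ∀ z, |A z| ≤ C := by
    intro z
    refine (hAd z).trans ?_
    have : Real.exp (-α * |z|) ≤ 1 := Real.exp_le_one_iff.2 (by nlinarith [abs_nonneg z])
    nlinarith
  have hint : MeasureTheory.Integrable (fun z => A z * deriv θ₀ z) := by
    refine (((aux_exp_integrable hα).const_mul C).mul_const B).mono'
      (hAc.mul hpc).aestronglyMeasurable (MeasureTheory.ae_of_all _ fun z => ?_)
    rw [Real.norm_eq_abs, abs_mul]
    exact mul_le_mul (hAd z) (hB z) (abs_nonneg _) ((abs_nonneg _).trans (hAd z))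
  have hex : (∫ z : ℝ, A z * deriv θ₀ z) = 0 → _ := fun h0 =>
    aux_exist P1 P2 hp hqc hAc hα hAd ht hb hint h0
  refine ⟨⟨?_, ?_⟩, ?_⟩
  · rintro ⟨c, hc, ⟨M, hM⟩, hce⟩
    obtain ⟨h1, h2⟩ := aux_cd2' hc
    obtain ⟨hd, hl⟩ := aux_wronskian P1 P2 hQ hAN h1 h2 hce hM
    have := MeasureTheory.integral_of_hasDerivAt_of_tendsto hd hint (hl _ hpb hfb) (hl _ hpt hft)
    simpa using this
  · intro h0
    obtain ⟨c, h1, h2, h3, -⟩ := hex h0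
    exact ⟨c, h1, h2, h3⟩
  · intro h0
    obtain ⟨c, hc⟩ := hex h0
    refine ⟨c, hc, ?_⟩
    rintro d ⟨hd, ⟨M, hM⟩, hde, hd0⟩
    obtain ⟨hcc, ⟨N, hN⟩, hce, hc0⟩ := hc
    obtain ⟨c1, c2⟩ := aux_cd2' hcc
    obtain ⟨d1, d2⟩ := aux_cd2' hd
    obtain ⟨hW, hl⟩ := aux_wronskian (A := fun _ => 0) (N := 0)
      (c := fun z => d z - c z) (M := M + N) P1 P2 hQ (by simp)
      (fun z => (d1 z).sub (c1 z)) (fun z => (d2 z).sub (c2 z))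
      (fun z => by linarith [hde z, hce z])
      (fun z => (abs_sub _ _).trans (add_le_add (hM z) (hN z)))
    have hWc : ∀ z, (deriv d z - deriv c z) * deriv θ₀ z - (d z - c z) * f (θ₀ z) = 0 := by
      intro z
      have hconst := is_const_of_deriv_eq_zero (fun z => (hW z).differentiableAt)
        (fun z => by rw [(hW z).deriv, zero_mul])
      have hlim := hl _ hpt hft
      refine tendsto_nhds_unique ?_ hlim
      exact tendsto_const_nhds.congr fun y => hconst z y
    have hr : ∀ z, HasDerivAt (fun z => (d z - c z) / deriv θ₀ z) 0 z := by
      intro z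
      have := ((d1 z).sub (c1 z)).div (P1 z) (hp z).ne'
      refine HasDerivAt.congr_deriv this ?_
      simp [hWc z]
    funext z
    have := is_const_of_deriv_eq_zero (fun z => (hr z).differentiableAt)
      (fun z => (hr z).deriv) z 0
    simp only [hd0, hc0, sub_zero, zero_div] at this
    rcases div_eq_zero_iff.1 this with h | h
    · linarith
    · exact absurd h (hp z).ne'
end
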